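/- Let R be a commutative noetherian ring with a dualizing module, let a and b be ideals of R, and let G be a Gorenstein injective R-module. Then the submodule Γ_a(G) + Γ_b(G) of G is a Gorenstein injective R-module. -/

import Mathlib

open CategoryTheory

universe u

/-- The `a`-torsion submodule `Γ_a(M) = {x ∈ M | a^n x = 0 for some n}`. -/
def torsionGamma {R : Type u} [CommRing R] (a : Ideal R) (M : Type u)
    [AddCommGroup M] [Module R M] : Submodule R M :=
  ⨆ n : ℕ, Submodule.torsionBySet R M ((a ^ n : Ideal R) : Set R)

/-- Data witnessing that `G` is Gorenstein injective: a ℤ-indexed exact complex of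
injective modules, remaining exact after `Hom_R(E', -)` for every injective `E'`,
with `G ≅ ker(E_0 → E_{-1})`. -/
structure GorensteinInjData (R : Type u) [CommRing R] (G : Type u)
    [AddCommGroup G] [Module R G] where
  E : ℤ → Type u
  [acg : ∀ i, AddCommGroup (E i)]
  [mod : ∀ i, Module R (E i)]
  d : ∀ i : ℤ, E (i + 1) →ₗ[R] E i
  inj : ∀ i, Module.Injective R (E i)
  exact : ∀ i : ℤ, LinearMap.range (d (i + 1)) = LinearMap.ker (d i)
  homExact : ∀ (E' : Type u) [AddCommGroup E'] [Module R E'], Module.Injective R E' →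
      ∀ (i : ℤ) (g : E' →ₗ[R] E (i + 1)),
        (d i).comp g = 0 ↔ ∃ f : E' →ₗ[R] E (i + 1 + 1), (d (i + 1)).comp f = g
  equiv : G ≃ₗ[R] LinearMap.ker (d (-1))

/-- An `R`-module `G` is Gorenstein injective. -/
def IsGorensteinInjective (R : Type u) [CommRing R] (G : Type u)
    [AddCommGroup G] [Module R G] : Prop :=
  Nonempty (GorensteinInjData R G)

/-- Data witnessing that `M` is Gorenstein flat. -/
structure GorensteinFlatData (R : Type u) [CommRing R] (M : Type u)
    [AddCommGroup M] [Module R M] where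
  F : ℤ → Type u
  [acg : ∀ i, AddCommGroup (F i)]
  [mod : ∀ i, Module R (F i)]
  d : ∀ i : ℤ, F (i + 1) →ₗ[R] F i
  flat : ∀ i, Module.Flat R (F i)
  exact : ∀ i : ℤ, LinearMap.range (d (i + 1)) = LinearMap.ker (d i)
  tensorExact : ∀ (E' : Type u) [AddCommGroup E'] [Module R E'], Module.Injective R E' →
      ∀ i : ℤ, LinearMap.range (LinearMap.lTensor E' (d (i + 1)))
        = LinearMap.ker (LinearMap.lTensor E' (d i))
  equiv : M ≃ₗ[R] LinearMap.ker (d (-1))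

/-- An `R`-module `M` is Gorenstein flat. -/
def IsGorensteinFlat (R : Type u) [CommRing R] (M : Type u)
    [AddCommGroup M] [Module R M] : Prop :=
  Nonempty (GorensteinFlatData R M)

/-- `E` is an injective hull of `M`: `E` is injective and admits an injective
linear map from `M` with essential image. -/
def IsInjectiveHull (R : Type u) [CommRing R] (M : Type u) [AddCommGroup M] [Module R M]
    (E : Type u) [AddCommGroup E] [Module R E] : Prop :=
  Module.Injective R E ∧ ∃ f : M →ₗ[R] E, Function.Injective f ∧
    ∀ N : Submodule R E, N ≠ ⊥ → N ⊓ LinearMap.range f ≠ ⊥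

/-- `D` is a dualizing module for `R`: finitely generated, of finite injective dimension,
the homothety map `R → Hom_R(D,D)` is bijective, and `Ext^i_R(D,D) = 0` for `i ≥ 1`. -/
def IsDualizingModule (R : Type u) [CommRing R] (D : Type u)
    [AddCommGroup D] [Module R D] : Prop :=
  Module.Finite R D ∧
  (∃ n : ℕ, ∀ (M : Type u) (_ : AddCommGroup M) (_ : Module R M), ∀ i : ℕ, n < i →
      Limits.IsZero (((Ext R (ModuleCat.{u} R) i).obj
        (Opposite.op (ModuleCat.of R M))).obj (ModuleCat.of R D))) ∧
  Function.Bijective (fun r : R => (r • (LinearMap.id : D →ₗ[R] D))) ∧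
  (∀ i : ℕ, 0 < i →
    Limits.IsZero (((Ext R (ModuleCat.{u} R) i).obj
      (Opposite.op (ModuleCat.of R D))).obj (ModuleCat.of R D)))

/-- The height of a prime ideal, as the `Order.height` of the corresponding
point of the prime spectrum. -/
noncomputable def idealHeight {R : Type u} [CommRing R] (p : Ideal R) (hp : p.IsPrime) : ℕ∞ :=
  Order.height (⟨p, hp⟩ : PrimeSpectrum R)

section helpers

variable {R : Type u} [CommRing R]

theorem gi_desc {A B C : Type*} [AddCommGroup A] [AddCommGroup B] [AddCommGroup C]
    [Module R A] [Module R B] [Module R C] (p : A →ₗ[R] B) (hp : Function.Surjective p)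
    (f : A →ₗ[R] C) (h : LinearMap.ker p ≤ LinearMap.ker f) : ∃ g : B →ₗ[R] C, g ∘ₗ p = f := by
  refine ⟨(LinearMap.ker p).liftQ f h ∘ₗ (p.quotKerEquivOfSurjective hp).symm.toLinearMap, ?_⟩
  ext a
  have : (p.quotKerEquivOfSurjective hp).symm (p a) = Submodule.Quotient.mk a := by
    rw [LinearEquiv.symm_apply_eq]; rfl
  simp [this]

theorem gi_cod {A B C : Type*} [AddCommGroup A] [AddCommGroup B] [AddCommGroup C]
    [Module R A] [Module R B] [Module R C] (i : B →ₗ[R] C) (hi : Function.Injective i)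
    (f : A →ₗ[R] C) (h : ∀ a, f a ∈ LinearMap.range i) : ∃ g : A →ₗ[R] B, i ∘ₗ g = f := by
  refine ⟨(LinearEquiv.ofInjective i hi).symm.toLinearMap ∘ₗ f.codRestrict _ h, ?_⟩
  ext a
  have := (LinearEquiv.ofInjective i hi).apply_symm_apply (f.codRestrict _ h a)
  simp

theorem gi_extend {A B C : Type u} [AddCommGroup A] [AddCommGroup B] [AddCommGroup C]
    [Module R A] [Module R B] [Module R C] (hC : Module.Injective R C) (i : A →ₗ[R] B)
    (hi : Function.Injective i) (f : A →ₗ[R] C) : ∃ g : B →ₗ[R] C, g ∘ₗ i = f :=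
  Module.Injective.extension_property R C A B i hi f

theorem gi_exists_inj (C : Type u) [AddCommGroup C] [Module R C] :
    ∃ (J : Type u) (_ : AddCommGroup J) (_ : Module R J) (i : C →ₗ[R] J),
      Module.Injective R J ∧ Function.Injective i := by
  let J := Injective.under (ModuleCat.of R C)
  refine ⟨J, inferInstance, inferInstance, (Injective.ι (ModuleCat.of R C)).hom, ?_, ?_⟩
  · rw [Module.injective_iff_injective_object]
    exact inferInstanceAs (Injective (Injective.under (ModuleCat.of R C)))
  · exact (ModuleCat.mono_iff_injective _).1 inferInstance

theorem gi_exists_ses (C : Type u) [AddCommGroup C] [Module R C] :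
    ∃ (J : Type u) (_ : AddCommGroup J) (_ : Module R J) (C' : Type u) (_ : AddCommGroup C')
      (_ : Module R C') (i : C →ₗ[R] J) (p : J →ₗ[R] C'),
      Module.Injective R J ∧ Function.Injective i ∧ Function.Surjective p ∧
        LinearMap.range i = LinearMap.ker p := by
  obtain ⟨J, _, _, f, hJ, hf⟩ := gi_exists_inj (R := R) C
  exact ⟨J, _, _, J ⧸ LinearMap.range f, _, _, f, (LinearMap.range f).mkQ, hJ, hf,
    Submodule.mkQ_surjective _, (Submodule.ker_mkQ _).symm⟩

theorem gi_exists_res (M : Type u) [AddCommGroup M] [Module R M] :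
    ∃ (P : ℕ → ModuleCat.{u} R) (d : ∀ i, P (i + 1) →ₗ[R] P i) (e : P 0 →ₗ[R] M),
      (∀ i, Module.Projective R (P i)) ∧ Function.Surjective e ∧
      LinearMap.range (d 0) = LinearMap.ker e ∧
      (∀ i, LinearMap.range (d (i + 1)) = LinearMap.ker (d i)) ∧
      ∀ (i : ℕ) (C : Type u) [AddCommGroup C] [Module R C],
        Limits.IsZero (((Ext R (ModuleCat.{u} R) (i + 1)).obj
          (Opposite.op (ModuleCat.of R M))).obj (ModuleCat.of R C)) →
        ∀ φ : P (i + 1) →ₗ[R] C, φ ∘ₗ d (i + 1) = 0 → ∃ ψ : P i →ₗ[R] C, ψ ∘ₗ d i = φ := by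
  let Q := projectiveResolution (ModuleCat.of R M)
  refine ⟨fun i => Q.complex.X i, fun i => (Q.complex.d (i + 1) i).hom, (Q.π.f 0).hom,
    ?_, ?_, ?_, ?_, ?_⟩
  · intro i
    rw [IsProjective.iff_projective]
    exact Q.projective i
  · exact (ModuleCat.epi_iff_surjective (Q.π.f 0)).1 inferInstance
  · exact (ShortComplex.moduleCat_exact_iff_range_eq_ker _).1 Q.exact₀
  · intro i
    exact (ShortComplex.moduleCat_exact_iff_range_eq_ker _).1 (Q.exact_succ i)
  · intro i C _ _ h φ hφ
    have h1 := h.of_iso (Q.isoExt (R := R) (i + 1) (ModuleCat.of R C)).symm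
    rw [← HomologicalComplex.exactAt_iff_isZero_homology,
      HomologicalComplex.exactAt_iff' _ i (i + 1) (i + 2) (by simp) (by simp),
      ShortComplex.moduleCat_exact_iff] at h1
    obtain ⟨ψ, hψ⟩ := h1 (ModuleCat.ofHom φ) (by
      simp only [HomologicalComplex.shortComplexFunctor'_obj_g]
      rw [ChainComplex.linearYonedaObj_d]
      apply ModuleCat.hom_ext
      exact hφ)
    simp only [HomologicalComplex.shortComplexFunctor'_obj_f] at hψ
    rw [ChainComplex.linearYonedaObj_d] at hψ
    exact ⟨ModuleCat.Hom.hom ψ, congrArg ModuleCat.Hom.hom hψ⟩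

/-- vanishing of Ext in a concrete form -/
def GIExtVan (M : Type u) [AddCommGroup M] [Module R M] (P : ℕ → ModuleCat.{u} R)
    (d : ∀ i, P (i + 1) →ₗ[R] P i) (i : ℕ) (C : Type u) [AddCommGroup C] [Module R C] : Prop :=
  ∀ φ : P (i + 1) →ₗ[R] C, φ ∘ₗ d (i + 1) = 0 → ∃ ψ : P i →ₗ[R] C, ψ ∘ₗ d i = φ

theorem gi_shift {M : Type u} [AddCommGroup M] [Module R M] (P : ℕ → ModuleCat.{u} R)
    (d : ∀ i, P (i + 1) →ₗ[R] P i) (hP : ∀ i, Module.Projective R (P i))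
    (hd : ∀ i, LinearMap.range (d (i + 1)) = LinearMap.ker (d i)) (i : ℕ)
    {C J C' : Type u} [AddCommGroup C] [Module R C] [AddCommGroup J] [Module R J]
    [AddCommGroup C'] [Module R C'] (f : C →ₗ[R] J) (p : J →ₗ[R] C')
    (hJ : Module.Injective R J) (hf : Function.Injective f) (hp : Function.Surjective p)
    (hfp : LinearMap.range f = LinearMap.ker p) (h : GIExtVan M P d (i + 1) C) :
    GIExtVan M P d i C' := by
  intro φ hφ
  obtain ⟨φ', hφ'⟩ := Module.projective_lifting_property p φ hp
  obtain ⟨k, hk⟩ := gi_cod f hf (φ' ∘ₗ d (i + 1)) (by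
    intro a
    rw [hfp, LinearMap.mem_ker]
    have := LinearMap.congr_fun hφ a
    rw [← hφ'] at this
    simpa using this)
  obtain ⟨χ, hχ⟩ := h k (by
    ext a
    apply hf
    have h1 := LinearMap.congr_fun hk (d (i + 1 + 1) a)
    have h2 : d (i + 1) (d (i + 1 + 1) a) = 0 := by
      rw [← LinearMap.mem_ker, ← hd]; exact ⟨a, rfl⟩
    simp only [LinearMap.comp_apply] at h1 ⊢
    rw [h1, h2]; simp)
  -- φ' - f χ is a cocycle
  have hco : ∀ x, d i x = 0 → (φ' - f ∘ₗ χ) x = 0 := by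
    intro x hx
    rw [← LinearMap.mem_ker, ← hd] at hx
    obtain ⟨y, rfl⟩ := hx
    have h1 := LinearMap.congr_fun hk y
    have h2 := LinearMap.congr_fun hχ y
    simp only [LinearMap.comp_apply] at h1 h2
    simp [h1, h2]
  obtain ⟨g, hg⟩ := gi_desc (d i).rangeRestrict (LinearMap.surjective_rangeRestrict _)
    (φ' - f ∘ₗ χ) (by
      intro x hx
      rw [LinearMap.mem_ker] at hx ⊢
      exact hco x (congrArg Subtype.val hx))
  obtain ⟨g', hg'⟩ := gi_extend hJ (LinearMap.range (d i)).subtype (Submodule.subtype_injective _) g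
  refine ⟨p ∘ₗ g', ?_⟩
  ext x
  have h1 := LinearMap.congr_fun hg x
  have h2 := LinearMap.congr_fun hg' ((d i).rangeRestrict x)
  have h3 : g' (d i x) = φ' x - f (χ x) := by
    simp only [LinearMap.comp_apply] at h1 h2
    simpa [h1] using h2
  have h4 : p (f (χ x)) = 0 := by
    rw [← LinearMap.mem_ker, ← hfp]; exact ⟨_, rfl⟩
  simp [h3, h4, ← hφ']

theorem gi_lift {M : Type u} [AddCommGroup M] [Module R M] (P : ℕ → ModuleCat.{u} R)
    (d : ∀ i, P (i + 1) →ₗ[R] P i) (e : P 0 →ₗ[R] M) (hP : ∀ i, Module.Projective R (P i))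
    (he : Function.Surjective e) (hed : LinearMap.range (d 0) = LinearMap.ker e)
    (hd : ∀ i, LinearMap.range (d (i + 1)) = LinearMap.ker (d i))
    {C J C' : Type u} [AddCommGroup C] [Module R C] [AddCommGroup J] [Module R J]
    [AddCommGroup C'] [Module R C'] (f : C →ₗ[R] J) (p : J →ₗ[R] C')
    (hf : Function.Injective f) (hp : Function.Surjective p)
    (hfp : LinearMap.range f = LinearMap.ker p) (h : GIExtVan M P d 0 C) (φ : M →ₗ[R] C') :
    ∃ ψ : M →ₗ[R] J, p ∘ₗ ψ = φ := by
  obtain ⟨φ', hφ'⟩ := Module.projective_lifting_property p (φ ∘ₗ e) hp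
  have hed' : ∀ x, e (d 0 x) = 0 := fun x => by
    rw [← LinearMap.mem_ker, ← hed]; exact ⟨_, rfl⟩
  obtain ⟨k, hk⟩ := gi_cod f hf (φ' ∘ₗ d 0) (by
    intro a
    rw [hfp, LinearMap.mem_ker]
    have := LinearMap.congr_fun hφ' (d 0 a)
    simp only [LinearMap.comp_apply] at this ⊢
    rw [this, hed', map_zero])
  obtain ⟨χ, hχ⟩ := h k (by
    ext a
    apply hf
    have h1 := LinearMap.congr_fun hk (d 1 a)
    have h2 : d 0 (d 1 a) = 0 := by
      rw [← LinearMap.mem_ker, ← hd]; exact ⟨a, rfl⟩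
    simp only [LinearMap.comp_apply] at h1 ⊢
    rw [h1, h2]; simp)
  obtain ⟨g, hg⟩ := gi_desc e he (φ' - f ∘ₗ χ) (by
      rw [← hed]
      rintro _ ⟨y, rfl⟩
      have h1 := LinearMap.congr_fun hk y
      have h2 := LinearMap.congr_fun hχ y
      simp only [LinearMap.comp_apply] at h1 h2
      simp [h1, h2])
  refine ⟨g, ?_⟩
  ext m
  obtain ⟨x, rfl⟩ := he m
  have h1 := LinearMap.congr_fun hg x
  have h4 : p (f (χ x)) = 0 := by
    rw [← LinearMap.mem_ker, ← hfp]; exact ⟨_, rfl⟩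
  have h5 := LinearMap.congr_fun hφ' x
  simp only [LinearMap.comp_apply] at h1 h5 ⊢
  rw [h1]; simp [h4, h5]

theorem gi_retract {C J : Type u} [AddCommGroup C] [Module R C] [AddCommGroup J] [Module R J]
    (hJ : Module.Injective R J) (f : C →ₗ[R] J) (r : J →ₗ[R] C) (h : r ∘ₗ f = LinearMap.id) :
    Module.Injective R C := by
  constructor
  intro X Y _ _ _ _ i hi g
  obtain ⟨k, hk⟩ := gi_extend hJ i hi (f ∘ₗ g)
  refine ⟨r ∘ₗ k, fun x => ?_⟩
  have h1 := LinearMap.congr_fun hk x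
  have h2 := LinearMap.congr_fun h (g x)
  simp only [LinearMap.comp_apply, LinearMap.id_apply] at h1 h2 ⊢
  rw [h1, h2]

/-- Induction along an injective coresolution of a module of finite injective dimension,
all of whose cosyzygies have no higher self extensions from `D`. -/
theorem gi_coresolution_induction (D : Type u) [AddCommGroup D] [Module R D]
    (hD : IsDualizingModule R D)
    (Q : ∀ (C : Type u) [AddCommGroup C] [Module R C], Prop)
    (hinj : ∀ (C : Type u) [AddCommGroup C] [Module R C], Module.Injective R C → Q C)
    (hstep : ∀ (C J C' : Type u) [AddCommGroup C] [Module R C] [AddCommGroup J] [Module R J]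
      [AddCommGroup C'] [Module R C'] (f : C →ₗ[R] J) (p : J →ₗ[R] C'),
      Module.Injective R J → Function.Injective f → Function.Surjective p →
      LinearMap.range f = LinearMap.ker p →
      (∀ φ : D →ₗ[R] C', ∃ ψ : D →ₗ[R] J, p ∘ₗ ψ = φ) → Q C' → Q C) : Q D := by
  obtain ⟨hfin, ⟨n, hn⟩, -, hext⟩ := hD
  choose P d e hP he hed hd hE using fun M : ModuleCat.{u} R => gi_exists_res (R := R) M
  have key : ∀ (n : ℕ) (C : Type u) [AddCommGroup C] [Module R C],
      (∀ (M : Type u) [AddCommGroup M] [Module R M], ∀ i, n ≤ i →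
        GIExtVan M (P (ModuleCat.of R M)) (d (ModuleCat.of R M)) i C) →
      (∀ i, GIExtVan D (P (ModuleCat.of R D)) (d (ModuleCat.of R D)) i C) → Q C := by
    intro n
    induction n with
    | zero =>
      intro C _ _ h _
      apply hinj
      obtain ⟨J, _, _, C', _, _, f, p, hJ, hf, hp, hfp⟩ := gi_exists_ses (R := R) C
      obtain ⟨s, hs⟩ := gi_lift (M := C') (P (ModuleCat.of R C')) (d (ModuleCat.of R C'))
        (e (ModuleCat.of R C')) (hP _) (he _) (hed _) (hd _) f p hf hp hfp (h C' 0 le_rfl) LinearMap.id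
      obtain ⟨r, hr⟩ := gi_cod f hf (LinearMap.id - s ∘ₗ p) (by
        intro a
        rw [hfp, LinearMap.mem_ker]
        have := LinearMap.congr_fun hs (p a)
        simp only [LinearMap.comp_apply, LinearMap.id_apply] at this
        simp [this])
      apply gi_retract hJ f r
      ext c
      apply hf
      have := LinearMap.congr_fun hr (f c)
      simp only [LinearMap.comp_apply] at this
      have h0 : p (f c) = 0 := by
        rw [← LinearMap.mem_ker, ← hfp]; exact ⟨c, rfl⟩
      simp only [LinearMap.comp_apply, LinearMap.id_apply]
      rw [this]
      simp [h0]
    | succ n ih =>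
      intro C _ _ h h2
      obtain ⟨J, _, _, C', _, _, f, p, hJ, hf, hp, hfp⟩ := gi_exists_ses (R := R) C
      refine hstep C J C' f p hJ hf hp hfp
        ?_ (ih C' ?_ ?_)
      · exact gi_lift (M := D) (P (ModuleCat.of R D)) (d (ModuleCat.of R D))
          (e (ModuleCat.of R D)) (hP _) (he _) (hed _) (hd _) f p hf hp hfp (h2 0)
      · intro M _ _ i hi
        exact gi_shift _ _ (hP _) (hd _) i f p hJ hf hp hfp (h M (i + 1) (by omega))
      · intro i
        exact gi_shift _ _ (hP _) (hd _) i f p hJ hf hp hfp (h2 (i + 1))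
  refine key n D ?_ ?_
  · intro M _ _ i hi
    exact hE (ModuleCat.of R M) i D (hn M _ _ (i + 1) (by omega))
  · intro i
    exact hE (ModuleCat.of R D) i D (hext (i + 1) (by omega))

end helpers

section homex

variable {R : Type u} [CommRing R] {E : ℤ → Type u} [∀ i, AddCommGroup (E i)]
  [∀ i, Module R (E i)] (d : ∀ i : ℤ, E (i + 1) →ₗ[R] E i)

/-- `Hom(M, E)` is exact. -/
def GIHomEx (M : Type u) [AddCommGroup M] [Module R M] : Prop :=
  ∀ (i : ℤ) (g : M →ₗ[R] E (i + 1)), d i ∘ₗ g = 0 → ∃ f : M →ₗ[R] E (i + 1 + 1), d (i + 1) ∘ₗ f = g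

variable {d}

theorem GIHomEx.of_equiv {M N : Type u} [AddCommGroup M] [Module R M] [AddCommGroup N] [Module R N]
    (e : M ≃ₗ[R] N) (h : GIHomEx d M) : GIHomEx d N := by
  intro i g hg
  obtain ⟨f, hf⟩ := h i (g ∘ₗ e.toLinearMap) (by rw [← LinearMap.comp_assoc, hg]; simp)
  refine ⟨f ∘ₗ e.symm.toLinearMap, ?_⟩
  rw [← LinearMap.comp_assoc, hf]
  ext x; simp

theorem GIHomEx.finsupp {M : Type u} [AddCommGroup M] [Module R M]
    (h : GIHomEx d M) (ι : Type u) : GIHomEx d (ι →₀ M) := by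
  intro i g hg
  have := fun j : ι => h i (g ∘ₗ Finsupp.lsingle j) (by rw [← LinearMap.comp_assoc, hg]; simp)
  choose f hf using this
  refine ⟨Finsupp.lsum R f, ?_⟩
  ext j x
  have := LinearMap.congr_fun (hf j) x
  simpa using this

theorem GIHomEx.nat_finsupp {M : Type u} [AddCommGroup M] [Module R M]
    (h : GIHomEx d M) : GIHomEx d (ℕ →₀ M) := by
  intro i g hg
  have := fun j : ℕ => h i (g ∘ₗ Finsupp.lsingle j) (by rw [← LinearMap.comp_assoc, hg]; simp)
  choose f hf using this
  refine ⟨Finsupp.lsum R f, ?_⟩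
  ext j x
  have := LinearMap.congr_fun (hf j) x
  simpa using this

theorem GIHomEx.coker (hinj : ∀ i, Module.Injective R (E i))
    (hdd : ∀ i x, d i (d (i + 1) x) = 0)
    {A B C : Type u} [AddCommGroup A] [Module R A] [AddCommGroup B] [Module R B]
    [AddCommGroup C] [Module R C] (f : A →ₗ[R] B) (p : B →ₗ[R] C)
    (hf : Function.Injective f) (hp : Function.Surjective p)
    (hfp : LinearMap.range f = LinearMap.ker p) (hA : GIHomEx d A) (hB : GIHomEx d B) :
    GIHomEx d C := by
  have hpf : ∀ x, p (f x) = 0 := fun x => by rw [← LinearMap.mem_ker, ← hfp]; exact ⟨x, rfl⟩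
  intro i g hg
  obtain ⟨k, hk⟩ := hB i (g ∘ₗ p) (by rw [← LinearMap.comp_assoc, hg]; simp)
  obtain ⟨h, hh⟩ := hA (i + 1) (k ∘ₗ f) (by
    rw [← LinearMap.comp_assoc, hk]; ext x; simp [hpf])
  obtain ⟨h', hh'⟩ := gi_extend (hinj _) f hf h
  obtain ⟨q, hq⟩ := gi_desc p hp (k - d (i + 1 + 1) ∘ₗ h') (by
    rw [← hfp]
    rintro _ ⟨x, rfl⟩
    have h1 := LinearMap.congr_fun hh x
    have h2 := LinearMap.congr_fun hh' x
    simp only [LinearMap.comp_apply] at h1 h2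
    simp [h1, h2])
  refine ⟨q, ?_⟩
  ext c
  obtain ⟨b, rfl⟩ := hp c
  have h1 := LinearMap.congr_fun hq b
  have h2 := LinearMap.congr_fun hk b
  simp only [LinearMap.comp_apply] at h1 h2 ⊢
  rw [h1, ← h2]
  simp [hdd]

theorem GIHomEx.ker (hinj : ∀ i, Module.Injective R (E i))
    {A B C : Type u} [AddCommGroup A] [Module R A] [AddCommGroup B] [Module R B]
    [AddCommGroup C] [Module R C] (f : A →ₗ[R] B) (p : B →ₗ[R] C)
    (hdd : ∀ i x, d i (d (i + 1) x) = 0)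
    (hf : Function.Injective f) (hp : Function.Surjective p)
    (hfp : LinearMap.range f = LinearMap.ker p) (hB : GIHomEx d B) (hC : GIHomEx d C) :
    GIHomEx d A := by
  have hpf : ∀ x, p (f x) = 0 := fun x => by rw [← LinearMap.mem_ker, ← hfp]; exact ⟨x, rfl⟩
  intro i g hg
  obtain ⟨j, rfl⟩ : ∃ j, i = j + 1 := ⟨i - 1, by ring⟩
  obtain ⟨g', hg'⟩ := gi_extend (hinj _) f hf g
  obtain ⟨k, hk⟩ := gi_desc p hp (d (j + 1) ∘ₗ g') (by
    rw [← hfp]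
    rintro _ ⟨x, rfl⟩
    have h1 := LinearMap.congr_fun hg x
    have h2 := LinearMap.congr_fun hg' x
    simp only [LinearMap.comp_apply] at h1 h2
    simp [h1, h2])
  obtain ⟨k', hk'⟩ := hC j k (by
    ext c
    obtain ⟨b, rfl⟩ := hp c
    have h1 := LinearMap.congr_fun hk b
    simp only [LinearMap.comp_apply] at h1 ⊢
    rw [h1]; simp [hdd])
  obtain ⟨q, hq⟩ := hB (j + 1) (g' - k' ∘ₗ p) (by
    ext b
    have h1 := LinearMap.congr_fun hk b
    have h2 := LinearMap.congr_fun hk' (p b)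
    simp only [LinearMap.comp_apply] at h1 h2
    simp [h1, h2])
  refine ⟨q ∘ₗ f, ?_⟩
  ext a
  have h1 := LinearMap.congr_fun hq (f a)
  have h2 := LinearMap.congr_fun hg' a
  simp only [LinearMap.comp_apply] at h1 h2 ⊢
  rw [h1]; simp [h2, hpf]

theorem GIHomEx.telescope (hinj : ∀ i, Module.Injective R (E i))
    (hdd : ∀ i x, d i (d (i + 1) x) = 0)
    {Q : Type u} [AddCommGroup Q] [Module R Q] (hQ : GIHomEx d Q) (w : ℕ → Q →ₗ[R] Q)
    (hw : ∀ n x, w (n + 1) (w n x) = w n x) (N : Submodule R Q)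
    (hN : ∀ y, y ∈ N ↔ ∃ n x, w n x = y) : GIHomEx d N := by
  let σ : (ℕ →₀ Q) →ₗ[R] (ℕ →₀ Q) :=
    Finsupp.lsum R fun n => Finsupp.lsingle n - Finsupp.lsingle (n + 1) ∘ₗ w n
  let π : (ℕ →₀ Q) →ₗ[R] N :=
    Finsupp.lsum R fun n => (w n).codRestrict N fun x => (hN _).2 ⟨n, x, rfl⟩
  have hσs : ∀ n x, σ (Finsupp.single n x) = Finsupp.single n x - Finsupp.single (n + 1) (w n x) := by
    intro n x; simp [σ]
  have hπs : ∀ n x, (π (Finsupp.single n x) : Q) = w n x := by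
    intro n x; simp [π]
  have hfix : ∀ n m x, w (n + m + 1) (w n x) = w n x := by
    intro n m x
    induction m with
    | zero => exact hw n x
    | succ m ih =>
      rw [← ih]
      exact hw _ _
  have hcong : ∀ n m x, Finsupp.single n x - Finsupp.single (n + m + 1) (w n x) ∈ LinearMap.range σ := by
    intro n m x
    induction m with
    | zero => exact ⟨_, hσs n x⟩
    | succ m ih =>
      have h1 : Finsupp.single (n + m + 1) (w n x) - Finsupp.single (n + (m + 1) + 1) (w n x) ∈
          LinearMap.range σ := by
        refine ⟨Finsupp.single (n + m + 1) (w n x), ?_⟩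
        rw [hσs, hfix]; rfl
      have := Submodule.add_mem _ ih h1
      simpa using this
  have hσ0 : ∀ x, σ x 0 = x 0 := by
    intro x
    induction x using Finsupp.induction_linear with
    | zero => simp
    | add a b ha hb => simp [ha, hb]
    | single n a => rw [hσs]; simp
  have hσ1 : ∀ x n, σ x (n + 1) = x (n + 1) - w n (x n) := by
    intro x n
    induction x using Finsupp.induction_linear with
    | zero => simp
    | add a b ha hb => simp [ha, hb]; abel
    | single m a =>
      rw [hσs]
      by_cases h : m = n
      · subst h; simp
      · have : ¬ m + 1 = n + 1 := by omega
        simp [Finsupp.single_apply, h]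
  refine GIHomEx.coker hinj hdd σ π ?_ ?_ ?_ hQ.nat_finsupp hQ.nat_finsupp
  · rw [injective_iff_map_eq_zero]
    intro x hx
    ext n
    induction n with
    | zero => rw [← hσ0, hx]
    | succ n ih =>
      have := hσ1 x n
      rw [hx, ih] at this
      simpa using this.symm
  · rintro ⟨y, hy⟩
    obtain ⟨n, x, rfl⟩ := (hN y).1 hy
    exact ⟨Finsupp.single n x, Subtype.ext (hπs n x)⟩
  · apply le_antisymm
    · rintro _ ⟨x, rfl⟩
      rw [LinearMap.mem_ker]
      induction x using Finsupp.induction_linear with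
      | zero => simp
      | add a b ha hb => simp [ha, hb]
      | single n a =>
        rw [hσs, map_sub]
        apply Subtype.ext
        rw [Submodule.coe_sub, hπs, hπs, hw]; simp
    · intro x hx
      -- x is congruent to single m (π x) for large m
      have key : ∀ x : ℕ →₀ Q, ∃ m, ∀ m', m ≤ m' →
          x - Finsupp.single m' (π x : Q) ∈ LinearMap.range σ := by
        intro x
        induction x using Finsupp.induction_linear with
        | zero => exact ⟨0, fun m' _ => by simp⟩
        | add a b ha hb =>
          obtain ⟨m1, h1⟩ := ha
          obtain ⟨m2, h2⟩ := hb
          refine ⟨max m1 m2, fun m' hm' => ?_⟩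
          have := Submodule.add_mem _ (h1 m' (le_trans (le_max_left _ _) hm'))
            (h2 m' (le_trans (le_max_right _ _) hm'))
          convert this using 1
          simp; abel
        | single n a =>
          refine ⟨n + 1, fun m' hm' => ?_⟩
          obtain ⟨k, rfl⟩ : ∃ k, m' = n + k + 1 := ⟨m' - n - 1, by omega⟩
          rw [hπs]
          exact hcong n k a
      obtain ⟨m, hm⟩ := key x
      have := hm m le_rfl
      rw [LinearMap.mem_ker.1 hx] at this
      simpa using this

theorem GIHomEx.eklof (hinj : ∀ i, Module.Injective R (E i))
    (hdd : ∀ i x, d i (d (i + 1) x) = 0)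
    {L : Type u} [AddCommGroup L] [Module R L] (S : Set (Submodule R L)) (T : Submodule R L)
    (hT : ∀ A ∈ S, A ≤ T)
    (hne : ∃ A ∈ S, GIHomEx d A)
    (hsup : ∀ c ⊆ S, c.Nonempty → sSup c ∈ S)
    (hY : ∀ A ∈ S, A ≠ T → GIHomEx d A ∧ ∃ B ∈ S, GIHomEx d B ∧ A < B) : GIHomEx d T := by
  intro i g hg
  obtain ⟨g', hg'⟩ := gi_extend (hinj _) T.subtype (Submodule.subtype_injective _) g
  have hg'T : ∀ x (hx : x ∈ T), g' x = g ⟨x, hx⟩ := fun x hx => LinearMap.congr_fun hg' ⟨x, hx⟩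
  have hdg : ∀ x ∈ T, d i (g' x) = 0 := fun x hx => by
    rw [hg'T x hx]; exact LinearMap.congr_fun hg ⟨x, hx⟩
  have hlift : ∀ A : Submodule R L, A ≤ T → GIHomEx d A → ∃ f : A →ₗ[R] E (i + 1 + 1),
      ∀ x : A, d (i + 1) (f x) = g' x := by
    intro A hA h
    obtain ⟨f, hf⟩ := h i (g' ∘ₗ A.subtype) (by ext x; exact hdg _ (hA x.2))
    exact ⟨f, fun x => LinearMap.congr_fun hf x⟩
  let Z : Set (L →ₗ.[R] E (i + 1 + 1)) := {p | p.domain ∈ S ∧ ∀ x, d (i + 1) (p x) = g' x}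
  obtain ⟨A₀, hA₀, hA₀'⟩ := hne
  obtain ⟨f₀, hf₀⟩ := hlift A₀ (hT _ hA₀) hA₀'
  obtain ⟨p, -, hp⟩ := zorn_le_nonempty₀ Z (by
    intro c hcZ hc y hy
    have hdir : DirectedOn (· ≤ ·) c := hc.directedOn
    refine ⟨LinearPMap.sSup c hdir, ⟨?_, ?_⟩, fun z hz => LinearPMap.le_sSup hdir hz⟩
    · exact hsup _ (by rintro _ ⟨q, hq, rfl⟩; exact (hcZ hq).1) ⟨_, ⟨y, hy, rfl⟩⟩
    · rintro ⟨x, hx⟩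
      obtain ⟨q, hq, hxq⟩ := (LinearPMap.mem_domain_sSup_iff ⟨y, hy⟩ hdir).1 hx
      have h1 := LinearPMap.sSup_apply hdir hq ⟨x, hxq⟩
      have h2 := (hcZ hq).2 ⟨x, hxq⟩
      rw [← h1] at h2
      exact h2) ⟨A₀, f₀⟩ ⟨hA₀, hf₀⟩
  have hpZ : p ∈ Z := hp.prop
  by_cases hpT : p.domain = T
  · refine ⟨p.toFun ∘ₗ (Submodule.inclusion hpT.ge), ?_⟩
    ext x
    have := hpZ.2 (Submodule.inclusion hpT.ge x)
    rw [Submodule.coe_inclusion, hg'T x x.2] at this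
    exact this
  · exfalso
    obtain ⟨hpY, B, hB, hBY, hlt⟩ := hY _ hpZ.1 hpT
    obtain ⟨f, hf⟩ := hlift B (hT _ hB) hBY
    obtain ⟨h, hh⟩ := hpY (i + 1) (p.toFun - f ∘ₗ Submodule.inclusion hlt.le) (by
      ext x
      have h1 := hpZ.2 x
      have h2 := hf (Submodule.inclusion hlt.le x)
      have h1' : d (i + 1) (p.toFun x) = g' x := h1
      simp only [LinearMap.comp_apply, LinearMap.sub_apply, map_sub]
      rw [h1', h2]; simp)
    obtain ⟨h', hh'⟩ := gi_extend (hinj _) (Submodule.inclusion hlt.le)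
      (Submodule.inclusion_injective _) h
    let q : L →ₗ.[R] E (i + 1 + 1) := ⟨B, f + d (i + 1 + 1) ∘ₗ h'⟩
    have hq : q ∈ Z := ⟨hB, fun x => by
      change d (i + 1) (f x + d (i + 1 + 1) (h' x)) = _
      rw [map_add, hdd, hf, add_zero]⟩
    have hpq : p ≤ q := by
      refine ⟨hlt.le, ?_⟩
      intro x y hxy
      obtain rfl : y = Submodule.inclusion hlt.le x := Subtype.ext hxy.symm
      have h1 := LinearMap.congr_fun hh x
      have h2 := LinearMap.congr_fun hh' x
      simp only [LinearMap.comp_apply, LinearMap.sub_apply] at h1 h2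
      change p.toFun x = f (Submodule.inclusion hlt.le x) +
        d (i + 1 + 1) (h' (Submodule.inclusion hlt.le x))
      rw [h2, h1]; simp
    have := (hp.le_of_ge hq hpq).1
    exact absurd this (not_le_of_gt hlt)

end homex

section transfinite

variable {R : Type u} [CommRing R] {E : ℤ → Type u} [∀ i, AddCommGroup (E i)]
  [∀ i, Module R (E i)] {d : ∀ i : ℤ, E (i + 1) →ₗ[R] E i}

theorem GIHomEx.transfinite (hinj : ∀ i, Module.Injective R (E i))
    (hdd : ∀ i x, d i (d (i + 1) x) = 0)
    {L : Type u} [AddCommGroup L] [Module R L] {S : Type u} (N : Set S → Submodule R L)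
    (hmono : Monotone N)
    (hcont : ∀ c : Set (Set S), c.Nonempty → DirectedOn (· ⊆ ·) c → N (⋃₀ c) ≤ sSup (N '' c))
    (hcount : ∀ T : Set S, T.Countable → GIHomEx d (N T)) (T : Set S) : GIHomEx d (N T) := by
  induction hk : Cardinal.mk T using WellFoundedLT.induction generalizing T with
  | ind κ ih =>
  subst hk
  by_cases hT : T.Countable
  · exact hcount T hT
  rw [← Cardinal.le_aleph0_iff_set_countable, not_le] at hT
  obtain ⟨_, _, hord⟩ := Cardinal.exists_ord_eq_type_lt T
  have hIio : ∀ a : T, Cardinal.mk (Set.Iio a) < Cardinal.mk T := fun a => Cardinal.mk_Iio_lt a hord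
  have hIic : ∀ a : T, Cardinal.mk (Set.Iic a) < Cardinal.mk T := fun a => by
    rw [← Set.Iio_insert]
    exact lt_of_le_of_lt Cardinal.mk_insert_le (Cardinal.add_lt_of_lt hT.le (hIio a)
      (lt_trans Cardinal.one_lt_aleph0 hT))
  have hY : ∀ U : Set T, Cardinal.mk U < Cardinal.mk T → GIHomEx d (N (Subtype.val '' U)) := by
    intro U hU
    exact ih _ (lt_of_le_of_lt Cardinal.mk_image_le hU) _ rfl
  have hcT : N T ≤ sSup (Set.range fun a : T => N (Subtype.val '' (Set.Iic a))) := by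
    have hne : Nonempty T := by
      by_contra h
      rw [not_nonempty_iff] at h
      rw [Cardinal.mk_eq_zero] at hT
      exact absurd hT (by simp)
    have h1 : T = ⋃₀ (Set.range fun a : T => Subtype.val '' (Set.Iic a)) := by
      ext x
      simp only [Set.mem_sUnion, Set.mem_range, exists_exists_eq_and]
      constructor
      · intro hx; exact ⟨⟨x, hx⟩, ⟨x, hx⟩, le_refl _, rfl⟩
      · rintro ⟨a, ⟨b, _, rfl⟩⟩; exact b.2
    have h2 := hcont (Set.range fun a : T => Subtype.val '' (Set.Iic a)) (Set.range_nonempty _) (by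
      rintro _ ⟨a, rfl⟩ _ ⟨b, rfl⟩
      exact ⟨_, ⟨max a b, rfl⟩, Set.image_mono (Set.Iic_subset_Iic.2 (le_max_left _ _)),
        Set.image_mono (Set.Iic_subset_Iic.2 (le_max_right _ _))⟩)
    rw [← h1, ← Set.range_comp] at h2
    exact h2
  refine GIHomEx.eklof hinj hdd {A | ∃ U : Set T, IsLowerSet U ∧ A = N (Subtype.val '' U)} (N T)
    ?_ ?_ ?_ ?_
  · rintro _ ⟨U, -, rfl⟩
    exact hmono (by rintro _ ⟨x, -, rfl⟩; exact x.2)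
  · exact ⟨_, ⟨∅, isLowerSet_empty, rfl⟩, hcount _ (by simp)⟩
  · intro c hc ⟨A, hA⟩
    let c' : Set (Set T) := {U | IsLowerSet U ∧ N (Subtype.val '' U) ∈ c}
    refine ⟨⋃₀ c', isLowerSet_sUnion fun U hU => hU.1, ?_⟩
    apply le_antisymm
    · apply sSup_le
      intro B hB
      obtain ⟨U, hU, rfl⟩ := hc hB
      exact hmono (Set.image_mono (Set.subset_sUnion_of_mem (show U ∈ c' from ⟨hU, hB⟩)))
    · have h2 := hcont ((Set.image Subtype.val) '' c') (by
        obtain ⟨U, hU, rfl⟩ := hc hA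
        exact ⟨_, U, ⟨hU, hA⟩, rfl⟩) (by
        rintro _ ⟨U, hU, rfl⟩ _ ⟨V, hV, rfl⟩
        rcases hU.1.total hV.1 with h | h
        · exact ⟨_, ⟨V, hV, rfl⟩, Set.image_mono h, subset_rfl⟩
        · exact ⟨_, ⟨U, hU, rfl⟩, subset_rfl, Set.image_mono h⟩)
      rw [← Set.image_sUnion] at h2
      refine h2.trans (sSup_le_sSup ?_)
      rintro _ ⟨_, ⟨U, hU, rfl⟩, rfl⟩
      exact hU.2
  · rintro _ ⟨U, hU, rfl⟩ hne
    have hlt : ¬ N T ≤ N (Subtype.val '' U) := fun h => hne (le_antisymm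
      (hmono (by rintro _ ⟨x, -, rfl⟩; exact x.2)) h)
    have hex : ∃ a : T, ¬ N (Subtype.val '' (Set.Iic a)) ≤ N (Subtype.val '' U) := by
      by_contra hcon
      push Not at hcon
      apply hlt
      refine hcT.trans (sSup_le ?_)
      rintro _ ⟨a, rfl⟩
      exact hcon a
    obtain ⟨a, ha⟩ := hex
    have haU : U ⊆ Set.Iic a := by
      rcases hU.total (isLowerSet_Iic a) with h | h
      · exact h
      · exact absurd (hmono (Set.image_mono h)) ha
    refine ⟨hY U (lt_of_le_of_lt (Cardinal.mk_le_mk_of_subset haU) (hIic a)), _,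
      ⟨Set.Iic a, isLowerSet_Iic a, rfl⟩, hY _ (hIic a), ?_⟩
    exact lt_of_le_not_ge (hmono (Set.image_mono haU)) ha

theorem gi_flat_approx {F : Type u} [AddCommGroup F] [Module R F] [Module.Flat R F]
    (K₀ : Submodule R (F →₀ R)) (hK₀ : K₀.FG)
    (hK : K₀ ≤ LinearMap.ker (Finsupp.linearCombination R (id : F → F))) :
    ∃ u : (F →₀ R) →ₗ[R] (F →₀ R), (LinearMap.range u).FG ∧
      LinearMap.range u ≤ LinearMap.ker (Finsupp.linearCombination R (id : F → F)) ∧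
      ∀ k ∈ K₀, u k = k := by
  classical
  set π := Finsupp.linearCombination R (id : F → F) with hπ
  have hπs : Function.Surjective π := fun x => ⟨Finsupp.single x 1, by simp [hπ]⟩
  obtain ⟨s, hs⟩ := hK₀
  let X : Finset F := s.biUnion Finsupp.support
  let ι : (X →₀ R) →ₗ[R] (F →₀ R) := Finsupp.lmapDomain R R Subtype.val
  let ρ : (F →₀ R) →ₗ[R] (X →₀ R) := Finsupp.lcomapDomain Subtype.val Subtype.val_injective
  have hfix : ∀ k ∈ K₀, ι (ρ k) = k := by
    have : K₀ ≤ LinearMap.eqLocus (ι ∘ₗ ρ) LinearMap.id := by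
      rw [← hs, Submodule.span_le]
      intro k hk
      refine Finsupp.mapDomain_comapDomain _ Subtype.val_injective k ?_
      intro x hx
      exact ⟨⟨x, Finset.mem_biUnion.2 ⟨k, hk, hx⟩⟩, rfl⟩
    exact fun k hk => this hk
  have : Module.Finite R K₀ := Module.Finite.iff_fg.2 ⟨s, hs⟩
  obtain ⟨n, a, y, hxy, haf⟩ := Module.Flat.exists_factorization_of_comp_eq_zero_of_free
    (R := R) (K := K₀) (N := (X →₀ R)) (M := F) (f := ρ ∘ₗ K₀.subtype) (x := π ∘ₗ ι) (by
      ext k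
      change π (ι (ρ k)) = 0
      rw [hfix k k.2]; exact hK k.2)
  obtain ⟨y', hy'⟩ := Module.projective_lifting_property π y hπs
  refine ⟨(ι - y' ∘ₗ a) ∘ₗ ρ, ?_, ?_, ?_⟩
  · have h1 : (LinearMap.range (ι - y' ∘ₗ a)).FG := by
      rw [LinearMap.range_eq_map]
      exact Submodule.FG.map _ Module.Finite.fg_top
    have h2 : LinearMap.range ((ι - y' ∘ₗ a) ∘ₗ ρ) = LinearMap.range (ι - y' ∘ₗ a) := by
      apply LinearMap.range_comp_of_range_eq_top
      rw [LinearMap.range_eq_top]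
      intro x
      refine ⟨ι x, ?_⟩
      exact Finsupp.comapDomain_mapDomain _ Subtype.val_injective x
    rw [h2]; exact h1
  · rintro _ ⟨x, rfl⟩
    rw [LinearMap.mem_ker]
    have h1 := LinearMap.congr_fun hxy (ρ x)
    have h2 := LinearMap.congr_fun hy' (a (ρ x))
    simp only [LinearMap.comp_apply] at h1 h2
    simp [h1, h2]
  · intro k hk
    have h1 := LinearMap.congr_fun haf ⟨k, hk⟩
    have h2 := hfix k hk
    simp only [LinearMap.comp_apply, Submodule.subtype_apply] at h1
    simp [h1, h2]

theorem gi_flat_family {F : Type u} [AddCommGroup F] [Module R F] [Module.Flat R F] :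
    ∃ u : ℕ → Finset (LinearMap.ker (Finsupp.linearCombination R (id : F → F))) →
        ((F →₀ R) →ₗ[R] (F →₀ R)),
      (∀ n B, LinearMap.range (u n B) ≤ LinearMap.ker (Finsupp.linearCombination R (id : F → F))) ∧
      (∀ n B, ∀ k : LinearMap.ker (Finsupp.linearCombination R (id : F → F)), k ∈ B →
        u (n + 1) B (k : F →₀ R) = k) ∧
      (∀ n B B', B' ⊆ B → ∀ x, u (n + 1) B (u n B' x) = u n B' x) := by
  classical
  set K := LinearMap.ker (Finsupp.linearCombination R (id : F → F)) with hKdef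
  let U := {u : (F →₀ R) →ₗ[R] (F →₀ R) // (LinearMap.range u).FG ∧ LinearMap.range u ≤ K}
  have hstep : ∀ v : Finset K → U, ∃ w : Finset K → U, ∀ B,
      (∀ k : K, k ∈ B → (w B).1 (k : F →₀ R) = k) ∧ ∀ B', B' ⊆ B → ∀ x, (w B).1 ((v B').1 x) = (v B').1 x := by
    intro v
    have : ∀ B, ∃ w : U, (∀ k : K, k ∈ B → w.1 (k : F →₀ R) = k) ∧
        ∀ B', B' ⊆ B → ∀ x, w.1 ((v B').1 x) = (v B').1 x := by
      intro B
      obtain ⟨u, h1, h2, h3⟩ := gi_flat_approx (R := R) (F := F)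
        (Submodule.span R (B.image Subtype.val : Finset (F →₀ R)) ⊔
          ⨆ B' ∈ B.powerset, LinearMap.range (v B').1) (by
          apply Submodule.FG.sup
          · exact Submodule.fg_span (Finset.finite_toSet _)
          · exact Submodule.fg_biSup _ _ fun B' _ => (v B').2.1) (by
          apply sup_le
          · rw [Submodule.span_le]
            intro k hk
            obtain ⟨k', _, rfl⟩ := Finset.mem_image.1 hk
            exact k'.2
          · exact iSup₂_le fun B' _ => (v B').2.2)
      refine ⟨⟨u, h1, h2⟩, fun k hk => h3 _ ?_, fun B' hB' x => h3 _ ?_⟩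
      · exact Submodule.mem_sup_left (Submodule.subset_span (Finset.mem_coe.2 (Finset.mem_image_of_mem _ hk)))
      · refine Submodule.mem_sup_right ?_
        exact (le_iSup₂_of_le (f := fun B' (_ : B' ∈ B.powerset) => LinearMap.range (v B').1)
          B' (Finset.mem_powerset.2 hB') le_rfl) ⟨x, rfl⟩
    choose w hw using this
    exact ⟨w, hw⟩
  choose step hs using hstep
  let u : ℕ → Finset K → U := fun n => Nat.rec
    (fun _ => ⟨0, by rw [LinearMap.range_zero]; exact Submodule.fg_bot, by simp⟩)
    (fun _ v => step v) n
  exact ⟨fun n B => (u n B).1, fun n B => (u n B).2.2, fun n B k hk => (hs (u n) B).1 k hk,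
    fun n B B' h x => (hs (u n) B).2 B' h x⟩

set_option maxHeartbeats 1000000 in
theorem GIHomEx.tensor_flat (hinj : ∀ i, Module.Injective R (E i))
    (hdd : ∀ i x, d i (d (i + 1) x) = 0)
    {D F : Type u} [AddCommGroup D] [Module R D] [AddCommGroup F] [Module R F] [Module.Flat R F]
    (hD : GIHomEx d D) : GIHomEx d (TensorProduct R D F) := by
  classical
  have fam := gi_flat_family (R := R) (F := F)
  generalize hπ : Finsupp.linearCombination R (id : F → F) = π at fam
  have hπs : Function.Surjective π := fun x => ⟨Finsupp.single x 1, by simp [← hπ]⟩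
  generalize hK : LinearMap.ker π = K at fam
  obtain ⟨u, hu1, hu2, hu3⟩ := fam
  let v : ℕ → Finset K → (TensorProduct R D (F →₀ R) →ₗ[R] TensorProduct R D (F →₀ R)) :=
    fun n B => LinearMap.lTensor D (u n B)
  have hv3 : ∀ n B B', B' ⊆ B → ∀ x, v (n + 1) B (v n B' x) = v n B' x := by
    intro n B B' h x
    have : u (n + 1) B ∘ₗ u n B' = u n B' := LinearMap.ext (hu3 n B B' h)
    simp only [v]
    rw [← LinearMap.comp_apply, ← LinearMap.lTensor_comp, this]
  have hvle : ∀ n B B', B' ⊆ B → LinearMap.range (v n B') ≤ LinearMap.range (v (n + 1) B) := by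
    rintro n B B' h _ ⟨x, rfl⟩
    exact ⟨_, hv3 n B B' h x⟩
  have hvle' : ∀ n m B, LinearMap.range (v n B) ≤ LinearMap.range (v (n + m) B) := by
    intro n m B
    induction m with
    | zero => exact le_rfl
    | succ m ih => exact ih.trans (hvle _ _ _ subset_rfl)
  have hvle'' : ∀ n m B B', n < m → B' ⊆ B → LinearMap.range (v n B') ≤ LinearMap.range (v m B) := by
    intro n m B B' hnm h
    obtain ⟨k, rfl⟩ : ∃ k, m = n + 1 + k := ⟨m - n - 1, by omega⟩
    exact (hvle n B B' h).trans (hvle' _ _ _)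
  let N : Set K → Submodule R (TensorProduct R D (F →₀ R)) := fun T =>
    ⨆ p : {p : ℕ × Finset K // (p.2 : Set K) ⊆ T}, LinearMap.range (v p.1.1 p.1.2)
  have hNmem : ∀ T y, y ∈ N T ↔ ∃ (n : ℕ) (B : Finset K), (B : Set K) ⊆ T ∧ ∃ x, v n B x = y := by
    intro T y
    have : Nonempty {p : ℕ × Finset K // (p.2 : Set K) ⊆ T} := ⟨⟨(0, ∅), by simp⟩⟩
    simp only [N]
    rw [Submodule.mem_iSup_of_directed]
    · constructor
      · rintro ⟨⟨⟨n, B⟩, h⟩, x, hx⟩; exact ⟨n, B, h, x, hx⟩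
      · rintro ⟨n, B, h, x, hx⟩; exact ⟨⟨⟨n, B⟩, h⟩, x, hx⟩
    · rintro ⟨⟨n, B⟩, h⟩ ⟨⟨n', B'⟩, h'⟩
      refine ⟨⟨⟨max n n' + 1, B ∪ B'⟩, by simp at h h' ⊢; exact ⟨h, h'⟩⟩, ?_, ?_⟩
      · exact hvle'' _ _ _ _ (by simp) Finset.subset_union_left
      · exact hvle'' _ _ _ _ (by simp) Finset.subset_union_right
  have hQ : GIHomEx d (TensorProduct R D (F →₀ R)) :=
    (hD.finsupp F).of_equiv (TensorProduct.finsuppScalarRight R R D F).symm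
  have hNY : GIHomEx d (N Set.univ) := by
    apply GIHomEx.transfinite hinj hdd N
    · intro T T' h y hy
      obtain ⟨n, B, hB, x, hx⟩ := (hNmem _ _).1 hy
      exact (hNmem _ _).2 ⟨n, B, hB.trans h, x, hx⟩
    · intro c hc hdir y hy
      obtain ⟨n, B, hB, x, hx⟩ := (hNmem _ _).1 hy
      obtain ⟨T, hT, hBT⟩ := hdir.exists_mem_subset_of_finite_of_subset_sUnion hc
        (Finset.finite_toSet B) hB
      exact (le_sSup (Set.mem_image_of_mem N hT)) ((hNmem _ _).2 ⟨n, B, hBT, x, hx⟩)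
    · intro T hT
      have : Countable T := hT
      obtain ⟨e, he⟩ := exists_injective_nat T
      -- exhaust T by finite sets
      have hfin : ∀ n, {t : T | e t ≤ n}.Finite := fun n =>
        Set.Finite.preimage he.injOn (Set.finite_Iic n)
      let B : ℕ → Finset K := fun n => (hfin n).toFinset.image Subtype.val
      have hBmem : ∀ n k, k ∈ B n ↔ ∃ h : k ∈ T, e ⟨k, h⟩ ≤ n := by
        intro n k
        simp [B]
      have hBmono : ∀ n m, n ≤ m → B n ⊆ B m := by
        intro n m h k hk
        rw [hBmem] at hk ⊢
        exact ⟨hk.1, hk.2.trans h⟩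
      refine GIHomEx.telescope hinj hdd hQ (fun n => v n (B n))
        (fun n x => hv3 n _ _ (hBmono _ _ (Nat.le_succ n)) x) (N T) ?_
      intro y
      rw [hNmem]
      constructor
      · rintro ⟨n, C, hC, x, hx⟩
        have : ∃ m, C ⊆ B m := by
          refine ⟨C.attach.sup fun k => e ⟨k.1, hC k.2⟩, fun k hk => ?_⟩
          rw [hBmem]
          exact ⟨hC hk, Finset.le_sup (f := fun k : C => e ⟨k.1, hC k.2⟩)
            (Finset.mem_attach C ⟨k, hk⟩)⟩
        obtain ⟨m, hm⟩ := this
        refine ⟨max n m + 1, ?_⟩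
        exact hvle'' n (max n m + 1) _ _ (by omega) (hm.trans (hBmono _ _ (by omega))) ⟨x, hx⟩
      · rintro ⟨n, x, hx⟩
        exact ⟨n, B n, fun k hk => ((hBmem n k).1 hk).1, x, hx⟩
  have hexact := lTensor_exact (R := R) (M := K) (N := F →₀ R) (P := F) D (f := K.subtype) (g := π) (by
    rw [LinearMap.exact_iff, hK, Submodule.range_subtype]) hπs
  refine GIHomEx.coker hinj hdd (N Set.univ).subtype (LinearMap.lTensor D π)
    (Submodule.subtype_injective _) (LinearMap.lTensor_surjective D hπs) ?_ hNY hQ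
  rw [Submodule.range_subtype, LinearMap.exact_iff.1 hexact]
  apply le_antisymm
  · intro y hy
    obtain ⟨n, B, -, x, rfl⟩ := (hNmem _ _).1 hy
    have : u n B = K.subtype ∘ₗ (u n B).codRestrict K fun x => hu1 n B ⟨x, rfl⟩ := rfl
    simp only [v]
    rw [this, LinearMap.lTensor_comp]
    exact ⟨_, rfl⟩
  · rintro _ ⟨t, rfl⟩
    induction t using TensorProduct.induction_on with
    | zero => simp
    | add a b ha hb => rw [map_add]; exact Submodule.add_mem _ ha hb
    | tmul x k =>
      refine (hNmem _ _).2 ⟨1, {k}, by simp, TensorProduct.tmul R x k, ?_⟩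
      have := hu2 0 {k} k (by simp)
      simp only [v, LinearMap.lTensor_tmul, Submodule.subtype_apply]
      exact congrArg (fun z => TensorProduct.tmul R x z) this

end transfinite

section homflat

variable {R : Type u} [CommRing R]

theorem gi_matrix {J E' : Type u} [AddCommGroup J] [Module R J] [AddCommGroup E'] [Module R E']
    (hE : Module.Injective R E') {n m : ℕ} (A : Fin n → Fin m → R) (f : Fin n → (J →ₗ[R] E'))
    (h : ∀ x : Fin n → J, (∀ j, ∑ i, A i j • x i = 0) → ∑ i, f i (x i) = 0) :
    ∃ y : Fin m → (J →ₗ[R] E'), ∀ i, f i = ∑ j, A i j • y j := by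
  classical
  let T : (Fin n → J) →ₗ[R] (Fin m → J) :=
    LinearMap.pi fun j => ∑ i, A i j • LinearMap.proj i
  let F : (Fin n → J) →ₗ[R] E' := ∑ i, f i ∘ₗ LinearMap.proj i
  have hT : ∀ x j, T x j = ∑ i, A i j • x i := fun x j => by simp [T]
  have hF : ∀ x, F x = ∑ i, f i (x i) := fun x => by simp [F]
  obtain ⟨G, hG⟩ := gi_desc T.rangeRestrict T.surjective_rangeRestrict F (by
    rw [LinearMap.ker_rangeRestrict]
    intro x hx
    rw [LinearMap.mem_ker] at hx ⊢
    rw [hF]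
    refine h x fun j => ?_
    rw [← hT, hx]; rfl)
  obtain ⟨Y, hY⟩ := gi_extend hE (LinearMap.range T).subtype (Submodule.subtype_injective _) G
  have hYT : ∀ x, Y (T x) = F x := fun x => by
    rw [← hG, ← hY]; rfl
  refine ⟨fun j => Y ∘ₗ LinearMap.single R (fun _ => J) j, fun i => ?_⟩
  ext x
  have h1 : F (Pi.single i x) = f i x := by
    rw [hF, Finset.sum_eq_single i]
    · simp
    · intro b _ hb; simp [hb]
    · simp
  have h2 : T (Pi.single i x) = ∑ j, A i j • (Pi.single j x : Fin m → J) := by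
    ext k
    rw [hT, Finset.sum_eq_single i]
    · simp [Finset.sum_apply, Pi.single_apply]
    · intro b _ hb; simp [hb]
    · simp
  rw [← h1, ← hYT, h2]
  simp

theorem gi_flat_hom [IsNoetherianRing R] {J E' : Type u} [AddCommGroup J] [Module R J]
    [AddCommGroup E'] [Module R E'] (hJ : Module.Injective R J) (hE : Module.Injective R E') :
    Module.Flat R (J →ₗ[R] E') := by
  classical
  apply Module.Flat.of_forall_isTrivialRelation
  intro n r f hrf
  let L : (Fin n → R) →ₗ[R] R := ∑ i, r i • LinearMap.proj i
  have hL : ∀ c, L c = ∑ i, r i * c i := fun c => by simp [L]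
  obtain ⟨m, a, ha⟩ := Submodule.fg_iff_exists_fin_generating_family.1
    (IsNoetherian.noetherian (LinearMap.ker L))
  obtain ⟨y, hy⟩ := gi_matrix hE (fun i j => a j i) f (by
    intro x hx
    let X : (Fin n → R) →ₗ[R] J := ∑ i, (LinearMap.proj i).smulRight (x i)
    have hX : ∀ c, X c = ∑ i, c i • x i := fun c => by simp [X]
    obtain ⟨G, hG⟩ := gi_desc L.rangeRestrict L.surjective_rangeRestrict X (by
      rw [LinearMap.ker_rangeRestrict, ← ha, Submodule.span_le]
      rintro _ ⟨j, rfl⟩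
      change X (a j) = 0
      rw [hX, hx])
    obtain ⟨Y, hY⟩ := gi_extend hJ (LinearMap.range L).subtype (Submodule.subtype_injective _) G
    have hYL : ∀ x, Y (L x) = X x := fun x => by
      rw [← hG, ← hY]; rfl
    have hxi : ∀ i, x i = r i • Y 1 := by
      intro i
      have h1 := hYL (Pi.single i 1)
      have h2 : X (Pi.single i 1) = x i := by
        rw [hX, Finset.sum_eq_single i]
        · simp
        · intro b _ hb; simp [hb]
        · simp
      have h3 : L (Pi.single i 1) = r i • 1 := by
        rw [hL, Finset.sum_eq_single i]
        · simp
        · intro b _ hb; simp [hb]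
        · simp
      rw [← h2, ← h1, h3, map_smul]
    have := LinearMap.congr_fun hrf (Y 1)
    simp only [LinearMap.sum_apply, LinearMap.smul_apply, LinearMap.zero_apply] at this
    rw [← this]
    refine Finset.sum_congr rfl fun i _ => ?_
    rw [← map_smul, ← hxi])
  refine ⟨m, fun i j => a j i, y, hy, fun j => ?_⟩
  rw [← hL, ← LinearMap.mem_ker, ← ha]
  exact Submodule.subset_span ⟨j, rfl⟩

theorem GIHomEx.double [IsNoetherianRing R] {E : ℤ → Type u} [∀ i, AddCommGroup (E i)]
    [∀ i, Module R (E i)] {d : ∀ i : ℤ, E (i + 1) →ₗ[R] E i}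
    (hinj : ∀ i, Module.Injective R (E i)) (hdd : ∀ i x, d i (d (i + 1) x) = 0)
    {D : Type u} [AddCommGroup D] [Module R D] [Module.Finite R D] (hD : GIHomEx d D)
    {J E' : Type u} [AddCommGroup J] [Module R J] [AddCommGroup E'] [Module R E']
    (hJ : Module.Injective R J) (hE : Module.Injective R E') :
    GIHomEx d ((D →ₗ[R] J) →ₗ[R] E') := by
  classical
  have := gi_flat_hom hJ hE
  let θ : TensorProduct R D (J →ₗ[R] E') →ₗ[R] ((D →ₗ[R] J) →ₗ[R] E') :=
    TensorProduct.lift (LinearMap.mk₂ R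
      (fun x f => f ∘ₗ LinearMap.applyₗ x)
      (by intros; ext; simp) (by intros; ext; simp) (by intros; ext; simp) (by intros; ext; simp))
  have hθ : ∀ x f φ, θ (TensorProduct.tmul R x f) φ = f (φ x) := fun x f φ => rfl
  obtain ⟨n, p, hp⟩ := Module.Finite.exists_fin' R D
  let e : Fin n → D := fun i => p (Pi.single i 1)
  have hpe : ∀ c, p c = ∑ i, c i • e i := by
    intro c
    conv_lhs => rw [pi_eq_sum_univ' c]
    simp [e]
  obtain ⟨m, a, ha⟩ := Submodule.fg_iff_exists_fin_generating_family.1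
    (IsNoetherian.noetherian (LinearMap.ker p))
  refine (GIHomEx.tensor_flat hinj hdd (F := J →ₗ[R] E') hD).of_equiv
    (LinearEquiv.ofBijective θ ⟨?_, ?_⟩)
  · rw [injective_iff_map_eq_zero]
    intro t ht
    have : ∃ f : Fin n → (J →ₗ[R] E'), t = ∑ i, TensorProduct.tmul R (e i) (f i) := by
      clear ht
      induction t using TensorProduct.induction_on with
      | zero => exact ⟨0, by simp⟩
      | add x y hx hy =>
        obtain ⟨f, rfl⟩ := hx
        obtain ⟨g, rfl⟩ := hy
        exact ⟨f + g, by simp [TensorProduct.tmul_add, Finset.sum_add_distrib]⟩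
      | tmul x f =>
        obtain ⟨c, rfl⟩ := hp x
        refine ⟨fun i => c i • f, ?_⟩
        rw [hpe, TensorProduct.sum_tmul]
        simp [TensorProduct.smul_tmul]
    obtain ⟨f, rfl⟩ := this
    obtain ⟨y, hy⟩ := gi_matrix hE (fun i j => a j i) f (by
      intro x hx
      let X : (Fin n → R) →ₗ[R] J := ∑ i, (LinearMap.proj i).smulRight (x i)
      have hX : ∀ c, X c = ∑ i, c i • x i := fun c => by simp [X]
      obtain ⟨φ, hφ⟩ := gi_desc p hp X (by
        rw [← ha, Submodule.span_le]
        rintro _ ⟨j, rfl⟩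
        change X (a j) = 0
        rw [hX, hx])
      have h1 : ∀ i, φ (e i) = x i := by
        intro i
        have h2 : X (Pi.single i 1) = x i := by
          rw [hX, Finset.sum_eq_single i]
          · simp
          · intro b _ hb; simp [hb]
          · simp
        rw [← h2, ← hφ]; rfl
      have h3 := LinearMap.congr_fun ht φ
      rw [map_sum] at h3
      simp only [LinearMap.sum_apply, hθ, h1, LinearMap.zero_apply] at h3
      exact h3)
    have hae : ∀ j, ∑ i, a j i • e i = 0 := by
      intro j
      rw [← hpe, ← LinearMap.mem_ker, ← ha]
      exact Submodule.subset_span ⟨j, rfl⟩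
    have h4 : ∀ i, TensorProduct.tmul R (e i) (f i)
        = ∑ j, TensorProduct.tmul R (a j i • e i) (y j) := by
      intro i
      rw [hy i, TensorProduct.tmul_sum]
      simp [TensorProduct.smul_tmul]
    simp only [h4]
    rw [Finset.sum_comm]
    refine Finset.sum_eq_zero fun j _ => ?_
    rw [← TensorProduct.sum_tmul, hae, TensorProduct.zero_tmul]
  · intro h
    let ev : (D →ₗ[R] J) →ₗ[R] (Fin n → J) := LinearMap.pi fun i => LinearMap.applyₗ (e i)
    have hev : Function.Injective ev := by
      rw [injective_iff_map_eq_zero]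
      intro φ hφ
      ext x
      obtain ⟨c, rfl⟩ := hp x
      have : ∀ i, φ (e i) = 0 := fun i => congrFun hφ i
      rw [hpe, map_sum]
      simp [this]
    obtain ⟨H, hH⟩ := gi_extend hE ev hev h
    refine ⟨∑ i, TensorProduct.tmul R (e i) (H ∘ₗ LinearMap.single R (fun _ => J) i), ?_⟩
    ext φ
    rw [map_sum, LinearMap.sum_apply]
    simp only [hθ, LinearMap.comp_apply]
    rw [← map_sum, ← hH]
    change H _ = H (ev φ)
    congr 1
    ext i
    simp [ev, Finset.sum_apply, Pi.single_apply]

theorem GIHomEx.all_injective [IsNoetherianRing R] {E : ℤ → Type u} [∀ i, AddCommGroup (E i)]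
    [∀ i, Module R (E i)] {d : ∀ i : ℤ, E (i + 1) →ₗ[R] E i}
    (hinj : ∀ i, Module.Injective R (E i)) (hdd : ∀ i x, d i (d (i + 1) x) = 0)
    {D : Type u} [AddCommGroup D] [Module R D] (hDu : IsDualizingModule R D) (hD : GIHomEx d D)
    {E' : Type u} [AddCommGroup E'] [Module R E'] (hE : Module.Injective R E') :
    GIHomEx d E' := by
  have hfin := hDu.1
  have key : GIHomEx d ((D →ₗ[R] D) →ₗ[R] E') := by
    refine gi_coresolution_induction D hDu (fun C _ _ => GIHomEx d ((D →ₗ[R] C) →ₗ[R] E')) ?_ ?_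
    · intro C _ _ hC
      exact GIHomEx.double hinj hdd hD hC hE
    · intro C J C' _ _ _ _ _ _ f p hJ hf hp hfp hl hQ
      let f' : (D →ₗ[R] C) →ₗ[R] (D →ₗ[R] J) := f.compRight R
      let p' : (D →ₗ[R] J) →ₗ[R] (D →ₗ[R] C') := p.compRight R
      have hpf : ∀ x, p (f x) = 0 := fun x => by rw [← LinearMap.mem_ker, ← hfp]; exact ⟨x, rfl⟩
      have hp's : Function.Surjective p' := fun φ => hl φ
      have hf'i : Function.Injective f' := by
        rw [injective_iff_map_eq_zero]
        intro φ hφ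
        ext x
        apply hf
        rw [LinearMap.zero_apply, map_zero]
        exact LinearMap.congr_fun hφ x
      refine GIHomEx.coker hinj hdd (LinearMap.lcomp R E' p') (LinearMap.lcomp R E' f') ?_ ?_ ?_
        hQ (GIHomEx.double hinj hdd hD hJ hE)
      · intro g g' h
        ext φ
        obtain ⟨ψ, rfl⟩ := hp's φ
        exact LinearMap.congr_fun h ψ
      · intro g
        exact gi_extend hE f' hf'i g
      · apply le_antisymm
        · rintro _ ⟨g, rfl⟩
          rw [LinearMap.mem_ker]
          ext φ
          have : p' (f' φ) = 0 := by ext x; exact hpf _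
          simp [this]
        · intro g hg
          obtain ⟨k, hk⟩ := gi_desc p' hp's g (by
            intro φ hφ
            obtain ⟨ψ, rfl⟩ := gi_cod f hf φ (by
              intro x
              rw [hfp]
              exact LinearMap.congr_fun hφ x)
            exact LinearMap.congr_fun hg ψ)
          exact ⟨k, hk⟩
  let e₀ : R ≃ₗ[R] (D →ₗ[R] D) := LinearEquiv.ofBijective
    ((LinearMap.lsmul R D : R →ₗ[R] D →ₗ[R] D)) (by
      convert hDu.2.2.1 using 1
      ext r x
      rfl)
  exact key.of_equiv ((e₀.arrowCongr (LinearEquiv.refl R E')).symm.trans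
    (LinearMap.ringLmapEquivSelf R R E'))

theorem GIHomEx.of_all_injective {E : ℤ → Type u} [∀ i, AddCommGroup (E i)]
    [∀ i, Module R (E i)] {d : ∀ i : ℤ, E (i + 1) →ₗ[R] E i}
    (hinj : ∀ i, Module.Injective R (E i)) (hdd : ∀ i x, d i (d (i + 1) x) = 0)
    {D : Type u} [AddCommGroup D] [Module R D] (hDu : IsDualizingModule R D)
    (h : ∀ (E' : Type u) [AddCommGroup E'] [Module R E'], Module.Injective R E' → GIHomEx d E') :
    GIHomEx d D := by
  refine gi_coresolution_induction D hDu (fun C _ _ => GIHomEx d C) (fun C _ _ hC => h C hC) ?_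
  intro C J C' _ _ _ _ _ _ f p hJ hf hp hfp hl hQ
  exact GIHomEx.ker hinj f p hdd hf hp hfp (h J hJ) hQ

end homflat

section gammax

variable {R : Type u} [CommRing R]

/-- The submodule of elements killed by a power of `x`. -/
def giTor (x : R) (M : Type u) [AddCommGroup M] [Module R M] : Submodule R M where
  carrier := {e | ∃ n : ℕ, x ^ n • e = 0}
  zero_mem' := ⟨0, by simp⟩
  add_mem' := by
    rintro e e' ⟨n, hn⟩ ⟨n', hn'⟩
    refine ⟨n + n', ?_⟩
    rw [smul_add, pow_add, mul_smul, mul_smul, hn', smul_comm, hn]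
    simp
  smul_mem' := by
    rintro r e ⟨n, hn⟩
    exact ⟨n, by rw [smul_comm, hn, smul_zero]⟩

theorem mem_giTor {x : R} {M : Type u} [AddCommGroup M] [Module R M] {e : M} :
    e ∈ giTor x M ↔ ∃ n : ℕ, x ^ n • e = 0 := Iff.rfl

theorem giTor_map {x : R} {M N : Type u} [AddCommGroup M] [Module R M] [AddCommGroup N]
    [Module R N] (f : M →ₗ[R] N) {e : M} (h : e ∈ giTor x M) : f e ∈ giTor x N := by
  obtain ⟨n, hn⟩ := h
  exact ⟨n, by rw [← map_smul, hn, map_zero]⟩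

theorem giTor_unif {x : R} {M N : Type u} [AddCommGroup M] [Module R M] [AddCommGroup N]
    [Module R N] [Module.Finite R M] (g : M →ₗ[R] N) (h : ∀ m, g m ∈ giTor x N) :
    ∃ n : ℕ, ∀ m, x ^ n • g m = 0 := by
  classical
  obtain ⟨s, hs⟩ := Module.Finite.fg_top (R := R) (M := M)
  choose k hk using h
  refine ⟨s.sup k, fun m => ?_⟩
  have : (⊤ : Submodule R M) ≤ LinearMap.ker (x ^ (s.sup k) • g) := by
    rw [← hs, Submodule.span_le]
    intro m hm
    have hle : k m ≤ s.sup k := Finset.le_sup hm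
    change x ^ (s.sup k) • g m = 0
    rw [← Nat.sub_add_cancel hle, pow_add, mul_smul, hk, smul_zero]
  exact this (Submodule.mem_top (x := m))

theorem giTor_inj [IsNoetherianRing R] {M : Type u} [AddCommGroup M] [Module R M]
    (U : Submodule R M) (hU : Module.Injective R U) (x : R) :
    Module.Injective R (U ⊓ giTor x M : Submodule R M) := by
  apply Module.Baer.injective
  intro I g
  obtain ⟨n, hn⟩ := giTor_unif (x := x) ((U ⊓ giTor x M).subtype ∘ₗ g) (fun m => (g m).2.2)
  let K : ℕ →o Submodule R R := ⟨fun k => Submodule.comap (LinearMap.lsmul R R (x ^ k)) I, by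
    apply monotone_nat_of_le_succ
    intro k r hr
    change x ^ (k + 1) * r ∈ I
    rw [pow_succ', mul_assoc]
    exact I.mul_mem_left _ hr⟩
  obtain ⟨k, hk⟩ := monotone_stabilizes_iff_noetherian.2 (inferInstance : IsNoetherian R R) K
  have hIx : ∀ y : I, ∀ r, (y : R) = x ^ (k + n) * r → g y = 0 := by
    intro y r hy
    have h1 : r ∈ K (k + n) := by
      change x ^ (k + n) * r ∈ I
      rw [← hy]; exact y.2
    rw [← hk (k + n) (by omega)] at h1
    have h2 : y = x ^ n • (⟨x ^ k * r, h1⟩ : I) := by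
      ext
      rw [hy]
      change _ = x ^ n * (x ^ k * r)
      ring
    rw [h2, map_smul]
    ext
    exact hn _
  let δ : (I × R) →ₗ[R] R := LinearMap.coprod I.subtype (LinearMap.lsmul R R (x ^ (k + n)))
  have hδ : ∀ p, δ p = p.1 + x ^ (k + n) * p.2 := fun p => rfl
  let γ : (I × R) →ₗ[R] U := Submodule.inclusion inf_le_left ∘ₗ g ∘ₗ LinearMap.fst R I R
  have hγ : ∀ p, (γ p : M) = g p.1 := fun p => rfl
  obtain ⟨G, hG⟩ := gi_desc δ.rangeRestrict δ.surjective_rangeRestrict γ (by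
    rw [LinearMap.ker_rangeRestrict]
    intro p hp
    rw [LinearMap.mem_ker, hδ] at hp
    rw [LinearMap.mem_ker]
    ext
    rw [hγ, hIx p.1 (-p.2) (by linear_combination hp)]
    rfl)
  obtain ⟨Y, hY⟩ := gi_extend hU (LinearMap.range δ).subtype (Submodule.subtype_injective _) G
  have hYδ : ∀ x, Y (δ x) = γ x := fun x => by
    rw [← hG, ← hY]; rfl
  have htor : (Y 1 : M) ∈ giTor x M := by
    refine ⟨k + n, ?_⟩
    have h1 := hYδ (0, 1)
    have h2 : δ (0, 1) = x ^ (k + n) • 1 := by rw [hδ]; simp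
    rw [h2, map_smul] at h1
    have h3 := congrArg (Subtype.val) h1
    rw [hγ] at h3
    simpa using h3
  refine ⟨LinearMap.toSpanSingleton R _ ⟨Y 1, (Y 1).2, htor⟩, ?_⟩
  intro y hy
  have h1 := hYδ (⟨y, hy⟩, 0)
  have h2 : δ (⟨y, hy⟩, 0) = y • 1 := by rw [hδ]; simp
  rw [h2, map_smul] at h1
  ext
  have h3 := congrArg (Subtype.val) h1
  rw [hγ] at h3
  simpa using h3

theorem giTor_div [IsNoetherianRing R] {M : Type u} [AddCommGroup M] [Module R M]
    (U : Submodule R M) (hU : Module.Injective R U) (x : R) (n : ℕ) :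
    ∃ q σ : U →ₗ[R] U, (∀ u, (σ u : M) ∈ giTor x M) ∧ ∀ u, u = x ^ n • q u + σ u := by
  let W := U ⊓ giTor x M
  have hW : Module.Injective R W := giTor_inj U hU x
  let ι : W →ₗ[R] U := Submodule.inclusion inf_le_left
  have hι : ∀ w, (ι w : M) = w := fun _ => rfl
  have hιi : Function.Injective ι := Submodule.inclusion_injective _
  obtain ⟨ρ, hρ⟩ := gi_extend hW ι hιi LinearMap.id
  have hρ' : ∀ w, ρ (ι w) = w := fun w => LinearMap.congr_fun hρ w
  let V := LinearMap.ker ρ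
  let r : U →ₗ[R] V := (LinearMap.id - ι ∘ₗ ρ).codRestrict V (by
    intro u
    rw [LinearMap.mem_ker]
    simp [hρ'])
  have hr : ∀ u, ((r u : V) : U) = u - ι (ρ u) := fun _ => rfl
  have hV : Module.Injective R V := gi_retract hU V.subtype r (by
    ext v
    have : ρ v = 0 := v.2
    simp [hr, this])
  let m : V →ₗ[R] V := x ^ n • LinearMap.id
  have hm : ∀ v, m v = x ^ n • v := fun _ => rfl
  have hmi : Function.Injective m := by
    rw [injective_iff_map_eq_zero]
    intro v hv
    rw [hm] at hv
    have h1 : ((v : U) : M) ∈ giTor x M := ⟨n, by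
      have := congrArg (fun z : V => ((z : U) : M)) hv
      simpa using this⟩
    have h2 := hρ' ⟨v, (v : U).2, h1⟩
    have h3 : ι ⟨v, (v : U).2, h1⟩ = v := rfl
    have h4 : ρ v = 0 := v.2
    rw [h3, h4] at h2
    ext
    have := congrArg (Subtype.val) h2
    simpa using this.symm
  obtain ⟨q, hq⟩ := gi_extend hV m hmi LinearMap.id
  have hq' : ∀ v, q (x ^ n • v) = v := fun v => LinearMap.congr_fun hq v
  have hq'' : ∀ v, x ^ n • q v = v := fun v => by rw [← map_smul, hq']
  refine ⟨V.subtype ∘ₗ q ∘ₗ r, ι ∘ₗ ρ, fun u => (ρ u).2.2, fun u => ?_⟩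
  have h1 := congrArg (Subtype.val) (hq'' (r u))
  rw [hr] at h1
  change u = x ^ n • ((q (r u) : V) : U) + ι (ρ u)
  have h2 : ((x ^ n • q (r u) : V) : U) = x ^ n • ((q (r u) : V) : U) := rfl
  rw [← h2, h1]
  simp

variable {E : ℤ → Type u} [∀ i, AddCommGroup (E i)] [∀ i, Module R (E i)]

/-- A subcomplex of injectives which is exact after applying `Hom(M, -)`. -/
structure GIGood (d : ∀ i : ℤ, E (i + 1) →ₗ[R] E i) (M : Type u) [AddCommGroup M] [Module R M]
    (U : ∀ i, Submodule R (E i)) : Prop where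
  inj : ∀ i, Module.Injective R (U i)
  map : ∀ i e, e ∈ U (i + 1) → d i e ∈ U i
  hom : ∀ (i : ℤ) (g : M →ₗ[R] E (i + 1)), (∀ m, g m ∈ U (i + 1)) → d i ∘ₗ g = 0 →
    ∃ f : M →ₗ[R] E (i + 1 + 1), (∀ m, f m ∈ U (i + 1 + 1)) ∧ d (i + 1) ∘ₗ f = g

theorem GIGood.step [IsNoetherianRing R] {d : ∀ i : ℤ, E (i + 1) →ₗ[R] E i}
    (hdd : ∀ i x, d i (d (i + 1) x) = 0)
    {M : Type u} [AddCommGroup M] [Module R M] [Module.Finite R M]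
    {U : ∀ i, Submodule R (E i)} (h : GIGood d M U) (x : R) :
    GIGood d M (fun i => U i ⊓ giTor x (E i)) where
  inj i := giTor_inj (U i) (h.inj i) x
  map i e he := ⟨h.map i e he.1, giTor_map _ he.2⟩
  hom i g hg hdg := by
    obtain ⟨f, hfU, hf⟩ := h.hom i g (fun m => (hg m).1) hdg
    obtain ⟨n, hn⟩ := giTor_unif g (fun m => (hg m).2)
    have hf' : ∀ m, d (i + 1) (f m) = g m := fun m => LinearMap.congr_fun hf m
    obtain ⟨w, hwU, hw⟩ := h.hom (i + 1) (x ^ n • f) (fun m => (U _).smul_mem _ (hfU m)) (by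
      ext m
      simp [hf', hn])
    have hw' : ∀ m, d (i + 1 + 1) (w m) = x ^ n • f m := fun m => LinearMap.congr_fun hw m
    obtain ⟨q, σ, hσ, hqσ⟩ := giTor_div (U (i + 1 + 1 + 1)) (h.inj _) x n
    let w' : M →ₗ[R] U (i + 1 + 1 + 1) := w.codRestrict _ hwU
    let v : M →ₗ[R] E (i + 1 + 1 + 1) := (U _).subtype ∘ₗ q ∘ₗ w'
    have hv : ∀ m, w m = x ^ n • v m + (σ (w' m) : E (i + 1 + 1 + 1)) := fun m =>
      congrArg (Subtype.val) (hqσ (w' m))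
    refine ⟨f - d (i + 1 + 1) ∘ₗ v, fun m => ⟨?_, ?_⟩, ?_⟩
    · exact (U _).sub_mem (hfU m) (h.map _ _ (q (w' m)).2)
    · obtain ⟨k, hk⟩ := giTor_map (d (i + 1 + 1)) (hσ (w' m))
      refine ⟨k + n, ?_⟩
      have h1 : x ^ n • (f - d (i + 1 + 1) ∘ₗ v) m = d (i + 1 + 1) (σ (w' m)) := by
        have hc : (f - d (i + 1 + 1) ∘ₗ v) m = f m - d (i + 1 + 1) (v m) := rfl
        rw [hc, smul_sub, ← hw', hv, map_add, map_smul]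
        abel
      rw [pow_add, mul_smul, h1, hk]
    · ext m
      simp [hdd, hf']

theorem GIGood.finset [IsNoetherianRing R] {d : ∀ i : ℤ, E (i + 1) →ₗ[R] E i}
    (hinj : ∀ i, Module.Injective R (E i))
    (hdd : ∀ i x, d i (d (i + 1) x) = 0)
    {M : Type u} [AddCommGroup M] [Module R M] [Module.Finite R M]
    (h : GIHomEx d M) (s : Finset R) :
    GIGood d M (fun i => s.inf fun x => giTor x (E i)) := by
  classical
  induction s using Finset.induction_on with
  | empty =>
    refine ⟨fun i => ?_, ?_, ?_⟩
    · exact gi_retract (hinj i) (Submodule.subtype _) (LinearMap.codRestrict _ LinearMap.id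
        (fun c => by simp)) (by ext; rfl)
    · intro i e _; simp
    · intro i g _ hg
      obtain ⟨f, hf⟩ := h i g hg
      exact ⟨f, fun m => by simp, hf⟩
  | insert x s hx ih =>
    have := ih.step hdd x
    convert this using 2 with i
    rw [Finset.inf_insert, inf_comm]

theorem mem_torsionGamma {a : Ideal R} {M : Type u} [AddCommGroup M] [Module R M] {e : M} :
    e ∈ torsionGamma a M ↔ ∃ n : ℕ, ∀ r ∈ a ^ n, r • e = 0 := by
  unfold torsionGamma
  rw [Submodule.mem_iSup_of_directed]
  · simp [Submodule.mem_torsionBySet_iff]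
  · apply Monotone.directed_le
    intro n m h
    apply Submodule.torsionBySet_le_torsionBySet_of_subset
    exact Ideal.pow_le_pow_right h

theorem torsionGamma_map {a : Ideal R} {M N : Type u} [AddCommGroup M] [Module R M]
    [AddCommGroup N] [Module R N] (f : M →ₗ[R] N) {e : M} (h : e ∈ torsionGamma a M) :
    f e ∈ torsionGamma a N := by
  rw [mem_torsionGamma] at h ⊢
  obtain ⟨n, hn⟩ := h
  exact ⟨n, fun r hr => by rw [← map_smul, hn r hr, map_zero]⟩

theorem torsionGamma_anti {a b : Ideal R} (hab : a ≤ b) {M : Type u} [AddCommGroup M]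
    [Module R M] : torsionGamma b M ≤ torsionGamma a M := by
  intro e he
  rw [mem_torsionGamma] at he ⊢
  obtain ⟨n, hn⟩ := he
  exact ⟨n, fun r hr => hn r (Ideal.pow_right_mono hab n hr)⟩

theorem torsionGamma_eq_inf (s : Finset R) (M : Type u) [AddCommGroup M] [Module R M] :
    torsionGamma (Ideal.span (s : Set R)) M = s.inf fun x => giTor x M := by
  ext e
  rw [mem_torsionGamma, Submodule.mem_finsetInf]
  constructor
  · rintro ⟨n, hn⟩ x hx
    exact ⟨n, hn _ (Ideal.pow_mem_pow (Ideal.subset_span hx) n)⟩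
  · intro h
    let A : Ideal R := LinearMap.ker (LinearMap.toSpanSingleton R M e)
    have hA : ∀ r, r ∈ A ↔ r • e = 0 := fun r => by simp [A]
    obtain ⟨n, hn⟩ := Ideal.exists_pow_le_of_le_radical_of_fg
      (I := Ideal.span (s : Set R)) (J := A) (by
        rw [Ideal.span_le]
        intro x hx
        obtain ⟨n, hn⟩ := h x hx
        exact ⟨n, (hA _).2 hn⟩) ⟨s, rfl⟩
    exact ⟨n, fun r hr => (hA r).1 (hn hr)⟩

theorem torsionGamma_split [IsNoetherianRing R] {M : Type u} [AddCommGroup M] [Module R M]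
    (hM : Module.Injective R M) (a b : Ideal R) {z : M} (hz : z ∈ torsionGamma (a * b) M) :
    ∃ e₁ ∈ torsionGamma a M, ∃ e₂ ∈ torsionGamma b M, z = e₁ + e₂ := by
  rw [mem_torsionGamma] at hz
  obtain ⟨n, hn⟩ := hz
  obtain ⟨k, hk⟩ := Ideal.exists_pow_inf_eq_pow_smul a (b ^ n : Submodule R R)
  have hk' : a ^ (n + k) ⊓ b ^ n ≤ (a * b) ^ n := by
    have h1 := hk (n + k) (by omega)
    rw [Nat.add_sub_cancel] at h1
    intro r hr
    have h2 : r ∈ a ^ (n + k) • (⊤ : Submodule R R) ⊓ b ^ n := by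
      refine ⟨?_, hr.2⟩
      have := Submodule.smul_mem_smul hr.1 (Submodule.mem_top (R := R) (x := (1 : R)))
      simpa using this
    rw [h1] at h2
    rw [mul_pow]
    exact Submodule.smul_mono le_rfl inf_le_right h2
  let δ : R →ₗ[R] (R ⧸ a ^ (n + k)) × (R ⧸ b ^ n) :=
    LinearMap.prod (a ^ (n + k)).mkQ (b ^ n).mkQ
  obtain ⟨G, hG⟩ := gi_desc δ.rangeRestrict δ.surjective_rangeRestrict
    (LinearMap.toSpanSingleton R M z) (by
    rw [LinearMap.ker_rangeRestrict]
    intro r hr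
    have h1 : r ∈ a ^ (n + k) := (Submodule.Quotient.mk_eq_zero _).1 (congrArg Prod.fst hr)
    have h2 : r ∈ b ^ n := (Submodule.Quotient.mk_eq_zero _).1 (congrArg Prod.snd hr)
    exact hn r (hk' ⟨h1, h2⟩))
  obtain ⟨Y, hY⟩ := gi_extend hM (LinearMap.range δ).subtype (Submodule.subtype_injective _) G
  have hYδ : ∀ r, Y (δ r) = r • z := fun x => by
    have h1 := LinearMap.congr_fun hG x
    have h2 := LinearMap.congr_fun hY (δ.rangeRestrict x)
    exact h2.trans h1
  refine ⟨Y ((a ^ (n + k)).mkQ 1, 0), ?_, Y (0, (b ^ n).mkQ 1), ?_, ?_⟩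
  · rw [mem_torsionGamma]
    refine ⟨n + k, fun r hr => ?_⟩
    rw [← map_smul]
    have : r • ((a ^ (n + k)).mkQ 1, (0 : R ⧸ b ^ n)) = 0 := by
      ext
      · rw [Prod.smul_mk, ← map_smul]
        exact (Submodule.Quotient.mk_eq_zero _).2 (by simpa using hr)
      · simp
    rw [this, map_zero]
  · rw [mem_torsionGamma]
    refine ⟨n, fun r hr => ?_⟩
    rw [← map_smul]
    have : r • ((0 : R ⧸ a ^ (n + k)), (b ^ n).mkQ 1) = 0 := by
      ext
      · simp
      · rw [Prod.smul_mk, ← map_smul]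
        exact (Submodule.Quotient.mk_eq_zero _).2 (by simpa using hr)
    rw [this, map_zero]
  · rw [← map_add]
    have := hYδ 1
    rw [one_smul] at this
    rw [← this]
    congr 1
    simp [δ]

end gammax

section gifinal

variable {R : Type u} [CommRing R]

theorem GIGood.gamma [IsNoetherianRing R] {E : ℤ → Type u} [∀ i, AddCommGroup (E i)]
    [∀ i, Module R (E i)] {d : ∀ i : ℤ, E (i + 1) →ₗ[R] E i}
    (hinj : ∀ i, Module.Injective R (E i))
    (hdd : ∀ i x, d i (d (i + 1) x) = 0)
    {M : Type u} [AddCommGroup M] [Module R M] [Module.Finite R M]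
    (h : GIHomEx d M) (c : Ideal R) :
    GIGood d M (fun i => torsionGamma c (E i)) := by
  obtain ⟨s, hs⟩ := IsNoetherian.noetherian c
  have hs' : Ideal.span (s : Set R) = c := hs
  have := GIGood.finset hinj hdd h s
  simp only [← torsionGamma_eq_inf] at this
  rw [hs'] at this
  exact this

theorem gi_exact_R {E : ℤ → Type u} [∀ i, AddCommGroup (E i)]
    [∀ i, Module R (E i)] (d : ∀ i : ℤ, E (i + 1) →ₗ[R] E i)
    (hex : ∀ i : ℤ, LinearMap.range (d (i + 1)) = LinearMap.ker (d i)) : GIHomEx d R := by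
  intro i g hg
  have h1 : g 1 ∈ LinearMap.range (d (i + 1)) := by
    rw [hex]; exact LinearMap.congr_fun hg 1
  obtain ⟨y, hy⟩ := h1
  refine ⟨LinearMap.toSpanSingleton R _ y, ?_⟩
  ext
  simp [hy]

theorem gi_R_exact {E : ℤ → Type u} [∀ i, AddCommGroup (E i)]
    [∀ i, Module R (E i)] (d : ∀ i : ℤ, E (i + 1) →ₗ[R] E i)
    (hdd : ∀ i x, d i (d (i + 1) x) = 0) (h : GIHomEx d R) (i : ℤ) :
    LinearMap.range (d (i + 1)) = LinearMap.ker (d i) := by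
  apply le_antisymm
  · rintro _ ⟨x, rfl⟩
    exact hdd i x
  · intro x hx
    obtain ⟨f, hf⟩ := h i (LinearMap.toSpanSingleton R _ x) (by
      ext
      rw [LinearMap.mem_ker] at hx
      simp [hx])
    refine ⟨f 1, ?_⟩
    have := LinearMap.congr_fun hf 1
    simpa using this

theorem gi_hom_restrict {E : ℤ → Type u} [∀ i, AddCommGroup (E i)]
    [∀ i, Module R (E i)] (d : ∀ i : ℤ, E (i + 1) →ₗ[R] E i)
    (U : ∀ i, Submodule R (E i)) (E' : ℤ → Type u) [∀ i, AddCommGroup (E' i)]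
    [∀ i, Module R (E' i)] (d' : ∀ i : ℤ, E' (i + 1) →ₗ[R] E' i)
    (ι : ∀ i, E' i →ₗ[R] E i) (hι : ∀ i, Function.Injective (ι i))
    (hιU : ∀ i, LinearMap.range (ι i) = U i)
    (hd' : ∀ i x, ι i (d' i x) = d i (ι (i + 1) x))
    {M : Type u} [AddCommGroup M] [Module R M] (hM : GIGood d M U) : GIHomEx d' M := by
  intro i g hg
  obtain ⟨f, hfU, hf⟩ := hM.hom i (ι (i + 1) ∘ₗ g)
    (fun m => by rw [← hιU]; exact ⟨g m, rfl⟩) (by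
    ext m
    have := LinearMap.congr_fun hg m
    simp only [LinearMap.comp_apply, LinearMap.zero_apply] at this ⊢
    rw [← hd', this, map_zero])
  obtain ⟨f', hf'⟩ := gi_cod (ι (i + 1 + 1)) (hι _) f (fun m => by rw [hιU]; exact hfU m)
  refine ⟨f', ?_⟩
  ext m
  apply hι
  have h1 := LinearMap.congr_fun hf m
  have h2 := LinearMap.congr_fun hf' m
  simp only [LinearMap.comp_apply] at h1 h2 ⊢
  rw [hd', h2, h1]

theorem gi_equiv [IsNoetherianRing R] (a b : Ideal R) (G : Type u) [AddCommGroup G] [Module R G]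
    {A B C A' B' C' : Type u} [AddCommGroup A] [AddCommGroup B] [AddCommGroup C]
    [AddCommGroup A'] [AddCommGroup B'] [AddCommGroup C']
    [Module R A] [Module R B] [Module R C] [Module R A'] [Module R B'] [Module R C']
    (d₁ : A →ₗ[R] B) (d₀ : B →ₗ[R] C) (d₁' : A' →ₗ[R] B') (d₀' : B' →ₗ[R] C')
    (iA : A' →ₗ[R] A) (iB : B' →ₗ[R] B) (iC : C' →ₗ[R] C)
    (hA : Module.Injective R A)
    (hiA : LinearMap.range iA ≤ torsionGamma (a * b) A)
    (hiB : LinearMap.range iB = torsionGamma (a * b) B)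
    (hBi : Function.Injective iB) (hCi : Function.Injective iC)
    (h1 : ∀ x, iB (d₁' x) = d₁ (iA x)) (h0 : ∀ x, iC (d₀' x) = d₀ (iB x))
    (hdd : ∀ x, d₀ (d₁ x) = 0)
    (hex' : LinearMap.range d₁' = LinearMap.ker d₀')
    (eq : G ≃ₗ[R] LinearMap.ker d₀) :
    Nonempty ((torsionGamma a G ⊔ torsionGamma b G : Submodule R G) ≃ₗ[R] LinearMap.ker d₀') := by
  have hle : torsionGamma a G ⊔ torsionGamma b G ≤ torsionGamma (a * b) G :=
    sup_le (torsionGamma_anti (a := a * b) (b := a) (M := G) (fun r hr => (Ideal.mul_le_inf hr).1))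
      (torsionGamma_anti (a := a * b) (b := b) (M := G) (fun r hr => (Ideal.mul_le_inf hr).2))
  let φ₀ : G →ₗ[R] B := (LinearMap.ker d₀).subtype ∘ₗ eq.toLinearMap
  have hφ₀ : ∀ x, φ₀ x = (eq x : LinearMap.ker d₀) := fun _ => rfl
  obtain ⟨φ₁, hφ₁'⟩ := gi_cod iB hBi
    (φ₀ ∘ₗ (torsionGamma a G ⊔ torsionGamma b G : Submodule R G).subtype)
    (fun x => by rw [hiB]; exact torsionGamma_map φ₀ (hle x.2))
  have hφ₁ : ∀ x, iB (φ₁ x) = φ₀ x := fun x => LinearMap.congr_fun hφ₁' x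
  let φ : (torsionGamma a G ⊔ torsionGamma b G : Submodule R G) →ₗ[R] LinearMap.ker d₀' :=
    φ₁.codRestrict _ (fun x => by
      rw [LinearMap.mem_ker]
      apply hCi
      rw [h0, hφ₁, map_zero, hφ₀]
      exact (eq x).2)
  have hφ : ∀ x, iB (φ x) = φ₀ x := fun x => hφ₁ x
  refine ⟨LinearEquiv.ofBijective φ ⟨?_, ?_⟩⟩
  · intro x y hxy
    have h2 : φ₀ x = φ₀ y := by rw [← hφ, ← hφ, hxy]
    exact Subtype.ext (eq.injective (Subtype.ext h2))
  · intro z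
    have hz : (z : B') ∈ LinearMap.range d₁' := by
      rw [hex']; exact z.2
    obtain ⟨y, hy⟩ := hz
    let δ : A →ₗ[R] G := eq.symm.toLinearMap ∘ₗ
      d₁.codRestrict (LinearMap.ker d₀) (fun y => hdd y)
    have hδ : ∀ y, φ₀ (δ y) = d₁ y := by
      intro y
      rw [hφ₀]
      exact congrArg (Subtype.val) (eq.apply_symm_apply
        (d₁.codRestrict (LinearMap.ker d₀) (fun y => hdd y) y))
    obtain ⟨y₁, h₁, y₂, h₂, h⟩ := torsionGamma_split hA a b (hiA ⟨y, rfl⟩)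
    refine ⟨⟨δ (iA y), ?_⟩, ?_⟩
    · rw [h, map_add]
      exact Submodule.add_mem_sup (torsionGamma_map δ h₁) (torsionGamma_map δ h₂)
    · apply Subtype.ext
      apply hBi
      rw [hφ, hδ, ← hy, h1]

theorem gi_final [IsNoetherianRing R] {D : Type u} [AddCommGroup D] [Module R D]
    (hD : IsDualizingModule R D) (a b : Ideal R) (G : Type u) [AddCommGroup G] [Module R G]
    {E : ℤ → Type u} [∀ i, AddCommGroup (E i)]
    [∀ i, Module R (E i)] (d : ∀ i : ℤ, E (i + 1) →ₗ[R] E i)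
    (hinj : ∀ i, Module.Injective R (E i))
    (hdd : ∀ i x, d i (d (i + 1) x) = 0)
    (gR : GIGood d R (fun i => torsionGamma (a * b) (E i)))
    (gD : GIGood d D (fun i => torsionGamma (a * b) (E i)))
    (eq : G ≃ₗ[R] LinearMap.ker (d (-1)))
    (E' : ℤ → Type u) [∀ i, AddCommGroup (E' i)]
    [∀ i, Module R (E' i)] (d' : ∀ i : ℤ, E' (i + 1) →ₗ[R] E' i)
    (hinj' : ∀ i, Module.Injective R (E' i))
    (ι : ∀ i, E' i →ₗ[R] E i) (hι : ∀ i, Function.Injective (ι i))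
    (hιU : ∀ i, LinearMap.range (ι i) = torsionGamma (a * b) (E i))
    (hd' : ∀ i x, ι i (d' i x) = d i (ι (i + 1) x)) :
    IsGorensteinInjective R (torsionGamma a G ⊔ torsionGamma b G : Submodule R G) := by
  have hdd' : ∀ i x, d' i (d' (i + 1) x) = 0 := fun i x => by
    apply hι
    rw [hd', hd', hdd, map_zero]
  have hD' : GIHomEx d' D := gi_hom_restrict d _ E' d' ι hι hιU hd' gD
  have hR' : GIHomEx d' R := gi_hom_restrict d _ E' d' ι hι hιU hd' gR
  have hex' := gi_R_exact d' hdd' hR'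
  obtain ⟨e⟩ := gi_equiv a b G (d (-1 + 1)) (d (-1)) (d' (-1 + 1)) (d' (-1)) (ι (-1 + 1 + 1))
    (ι (-1 + 1)) (ι (-1)) (hinj _) (hιU _).le (hιU _) (hι _) (hι _) (hd' _) (hd' _) (hdd _)
    (hex' _) eq
  exact ⟨{ E := E'
           d := d'
           inj := hinj'
           exact := hex'
           homExact := by
             intro X _ _ hX i g
             constructor
             · exact fun hg => GIHomEx.all_injective hinj' hdd' hD hD' hX i g hg
             · rintro ⟨f, rfl⟩
               ext1 x
               exact hdd' i _
           equiv := e }⟩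

end gifinal

/-- `Γ_a(G) + Γ_b(G)` is Gorenstein injective. -/
theorem isGorensteinInjective_torsionGamma_sup
    {R : Type u} [CommRing R] [IsNoetherianRing R]
    (D : Type u) [AddCommGroup D] [Module R D] (hD : IsDualizingModule R D)
    (a b : Ideal R) (G : Type u) [AddCommGroup G] [Module R G]
    (hG : IsGorensteinInjective R G) :
    IsGorensteinInjective R (torsionGamma a G ⊔ torsionGamma b G : Submodule R G) := by
  obtain ⟨W⟩ := hG
  let _ := W.acg
  let _ := W.mod
  have hfin := hD.1
  have hdd : ∀ i x, W.d i (W.d (i + 1) x) = 0 := fun i x => by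
    rw [← LinearMap.mem_ker, ← W.exact]; exact ⟨x, rfl⟩
  have gR := GIGood.gamma W.inj hdd (gi_exact_R W.d W.exact) (a * b)
  have gD := GIGood.gamma W.inj hdd (GIHomEx.of_all_injective W.inj hdd hD
    (fun E' _ _ hE' i g hg => (W.homExact E' hE' i g).1 hg)) (a * b)
  exact gi_final hD a b G W.d W.inj hdd gR gD W.equiv
    (fun i => torsionGamma (a * b) (W.E i)) (fun i => (W.d i).restrict (gR.map i)) gR.inj
    (fun i => (torsionGamma (a * b) (W.E i)).subtype)
    (fun i => Submodule.subtype_injective _) (fun i => Submodule.range_subtype _)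
    (fun i x => rfl)
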